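/- arXiv:1206.1763 — 4 statements merged into one kernel-verified Lean document; each statement's English description precedes it below -/
import Mathlib

section
/- Under the assumptions of the previous statement, if additionally d(n) → ∞ as n → ∞, then the self-adjoint operator A = D + A' has compact resolvent. -/
open Filter

/- l²(ℕ*) is modeled as `lp (fun _ : ℕ => ℂ) 2` (index j ↔ paper index j+1;
the paper's convention "a_l(j-l) = 0, x(j-l) = 0 for j ≤ l" becomes the
`if l ≤ j` guards below). -/

/-- the off-diagonal band operator `A'`. -/
noncomputable def offDiagOp (m : ℕ) (a : ℕ → ℕ → ℝ) (x : ℕ → ℂ) (j : ℕ) : ℂ :=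
  ∑ l ∈ Finset.Icc 1 m, ((a l j : ℂ) * x (j + l) +
    if l ≤ j then (a l (j - l) : ℂ) * x (j - l) else 0)

/-- the full band operator `A = D + A'`. -/
noncomputable def bandOp (m : ℕ) (d : ℕ → ℝ) (a : ℕ → ℕ → ℝ) (x : ℕ → ℂ) (j : ℕ) : ℂ :=
  (d j : ℂ) * x j + offDiagOp m a x j

/-- `lam` is the nondecreasing enumeration (with multiplicity) of the eigenvalues
of the self-adjoint operator `A = D + A'` with compact resolvent: there is an
orthonormal basis `(v n)` of `l²` with `A (v n) = lam n • v n` and `lam n → ∞`,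
`lam` nondecreasing. -/
def IsEigenSystem (m : ℕ) (d : ℕ → ℝ) (a : ℕ → ℕ → ℝ)
    (lam : ℕ → ℝ) (v : ℕ → lp (fun _ : ℕ => ℂ) 2) : Prop :=
  Orthonormal ℂ v ∧
  (Submodule.span ℂ (Set.range v)).topologicalClosure = ⊤ ∧
  Monotone lam ∧ Tendsto lam atTop atTop ∧
  ∀ n j, bandOp m d a ((v n : lp (fun _ : ℕ => ℂ) 2) : ∀ _ : ℕ, ℂ) j
    = (lam n : ℂ) * (v n : ∀ _ : ℕ, ℂ) j

/-- the standing assumptions on `A = D + A'`: the relative decay condition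
(|a_l(j-l)|+|a_l(j)|)/d(j) → 0 ensuring self-adjointness, and d(n) → ∞
ensuring compactness of the resolvent. -/
def StandingAssumptions (m : ℕ) (d : ℕ → ℝ) (a : ℕ → ℕ → ℝ) : Prop :=
  (∀ l ∈ Finset.Icc 1 m, Tendsto
    (fun j => ((if l ≤ j then |a l (j - l)| else 0) + |a l j|) / d j) atTop (nhds 0)) ∧
  Tendsto d atTop atTop

noncomputable abbrev H2 : Type := lp (fun _ : ℕ => ℂ) 2

lemma exists_wop (c : ℕ → ℂ) (C : ℝ) (hC : 0 ≤ C) (hc : ∀ j, ‖c j‖ ≤ C) (f : ℕ → ℕ)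
    (hf : Function.Injective f) :
    ∃ T : H2 →L[ℂ] H2, (∀ x j, (T x : ∀ _ : ℕ, ℂ) j = c j * (x : ∀ _ : ℕ, ℂ) (f j)) ∧ ‖T‖ ≤ C := by
  have h2 : (0:ℝ) < (2:ENNReal).toReal := by norm_num
  have key : ∀ (x : H2) (s : Finset ℕ),
      ∑ j ∈ s, ‖c j * (x : ∀ _ : ℕ, ℂ) (f j)‖ ^ (2:ENNReal).toReal
        ≤ (C * ‖x‖) ^ (2:ENNReal).toReal := by
    intro x s
    have h1 := lp.sum_rpow_le_norm_rpow h2 x (s.map ⟨f, hf⟩)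
    rw [Finset.sum_map] at h1
    simp only [Function.Embedding.coeFn_mk] at h1
    rw [Real.mul_rpow hC (norm_nonneg _)]
    refine le_trans ?_ (mul_le_mul_of_nonneg_left h1 (by positivity))
    rw [Finset.mul_sum]
    refine Finset.sum_le_sum fun j _ => ?_
    rw [norm_mul, Real.mul_rpow (norm_nonneg _) (norm_nonneg _)]
    gcongr
    exact hc j
  let L : H2 →ₗ[ℂ] H2 :=
    { toFun := fun x => ⟨fun j => c j * (x : ∀ _ : ℕ, ℂ) (f j), memℓp_gen' (key x)⟩
      map_add' := by
        intro x y; ext j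
        exact mul_add _ _ _
      map_smul' := by
        intro r x; ext j
        exact mul_left_comm _ _ _ }
  have hL : ∀ x, ‖L x‖ ≤ C * ‖x‖ := fun x =>
    lp.norm_le_of_forall_sum_le h2 (by positivity) (key x)
  exact ⟨L.mkContinuous C hL, fun x j => rfl, L.mkContinuous_norm_le hC hL⟩

lemma exists_diag (c : ℕ → ℂ) (hc : Tendsto c atTop (nhds 0)) :
    ∃ T : H2 →L[ℂ] H2, (∀ x j, (T x : ∀ _ : ℕ, ℂ) j = c j * (x : ∀ _ : ℕ, ℂ) j) ∧
      IsCompactOperator T := by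
  obtain ⟨C, hC⟩ := (Metric.isBounded_range_of_tendsto c hc).exists_norm_le
  have hC' : ∀ j, ‖c j‖ ≤ C := fun j => hC _ ⟨j, rfl⟩
  have hC0 : 0 ≤ C := (norm_nonneg _).trans (hC' 0)
  obtain ⟨T, hT, -⟩ := exists_wop c C hC0 hC' id Function.injective_id
  refine ⟨T, hT, ?_⟩
  let r : ℕ → (H2 →L[ℂ] H2) := fun k =>
    (lp.singleContinuousLinearMap ℂ (fun _ : ℕ => ℂ) 2 k).comp
      (c k • lp.evalCLM ℂ (fun _ : ℕ => ℂ) 2 k)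
  have hr : ∀ k, IsCompactOperator (r k) := fun k => by
    have : IsCompactOperator (c k • lp.evalCLM ℂ (fun _ : ℕ => ℂ) 2 k) :=
      isCompactOperator_of_locallyCompactSpace_dom _
    exact this.clm_comp (lp.singleContinuousLinearMap ℂ (fun _ : ℕ => ℂ) 2 k)
  have hrv : ∀ k (x : H2) j, (r k x : ∀ _ : ℕ, ℂ) j
      = if j = k then c j * (x : ∀ _ : ℕ, ℂ) j else 0 := by
    intro k x j
    have : r k x = lp.single 2 k (c k * (x : ∀ _ : ℕ, ℂ) k) := rfl
    rw [this, lp.single_apply, Pi.single_apply]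
    split_ifs with h <;> simp [h]
  let S : ℕ → (H2 →L[ℂ] H2) := fun N => ∑ k ∈ Finset.range N, r k
  have hS : ∀ N, IsCompactOperator (S N) := by
    intro N
    have : S N ∈ compactOperator (RingHom.id ℂ) H2 H2 := Submodule.sum_mem _ fun k _ => hr k
    exact this
  have hSv : ∀ N (x : H2) j, (S N x : ∀ _ : ℕ, ℂ) j
      = if j < N then c j * (x : ∀ _ : ℕ, ℂ) j else 0 := by
    intro N x j
    induction N with
    | zero => simp [S]
    | succ N ih =>
      have : S (N+1) x = S N x + r N x := by
        simp [S, Finset.sum_range_succ]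
      rw [this, lp.coeFn_add, Pi.add_apply, ih, hrv]
      by_cases h1 : j < N
      · simp [h1, h1.ne, Nat.lt_succ_of_lt h1]
      · by_cases h2 : j = N
        · simp [h2]
        · have : ¬ j < N + 1 := by omega
          simp [h1, h2, this]
  refine isCompactOperator_of_tendsto (F := S) (l := atTop) (f := T) ?_ (Eventually.of_forall hS)
  rw [Metric.tendsto_atTop]
  intro ε hε
  obtain ⟨N, hN⟩ := (Metric.tendsto_atTop.1 hc) (ε/2) (by positivity)
  refine ⟨N, fun n hn => ?_⟩
  obtain ⟨U, hU, hUn⟩ := exists_wop (fun j => if j < n then 0 else - c j) (ε/2) (by positivity)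
    (fun j => by
      split_ifs with h
      · simp; positivity
      · have := hN j (by omega)
        rw [dist_zero_right] at this
        simpa using this.le) id Function.injective_id
  have : S n - T = U := by
    ext x j
    have e : ((S n - T) x : ∀ _ : ℕ, ℂ) j
      = (S n x : ∀ _ : ℕ, ℂ) j - (T x : ∀ _ : ℕ, ℂ) j := rfl
    rw [e, hSv, hT, hU]
    split_ifs <;> simp
  rw [dist_eq_norm, this]
  linarith

lemma exists_shift (l : ℕ) : ∃ L R : H2 →L[ℂ] H2,
    (∀ x j, (L x : ∀ _ : ℕ, ℂ) j = (x : ∀ _ : ℕ, ℂ) (j + l)) ∧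
    (∀ x j, (R x : ∀ _ : ℕ, ℂ) j = if l ≤ j then (x : ∀ _ : ℕ, ℂ) (j - l) else 0) ∧
    (∀ x y, inner ℂ x (R y) = inner ℂ (L x) y) := by
  obtain ⟨L, hL, -⟩ := exists_wop (fun _ => 1) 1 zero_le_one (by simp) (fun j => j + l)
    (add_left_injective l)
  refine ⟨L, ContinuousLinearMap.adjoint L, by simpa using hL, ?_, ?_⟩
  · intro x j
    have h1 := ContinuousLinearMap.adjoint_inner_right L (lp.single 2 j (1:ℂ)) x
    rw [lp.inner_single_left] at h1
    have h2 : L (lp.single 2 j (1:ℂ)) = if l ≤ j then lp.single 2 (j - l) (1:ℂ) else 0 := by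
      ext k
      rw [hL]
      split_ifs with h
      · simp only [lp.single_apply, Pi.single_apply, one_mul]
        congr 1
        simp; omega
      · have : k + l ≠ j := by omega
        simp [lp.single_apply, Pi.single_apply, this]
    rw [h2] at h1
    split_ifs at h1 ⊢ with h
    · rw [lp.inner_single_left] at h1
      simpa using h1
    · simpa using h1
  · intro x y
    exact ContinuousLinearMap.adjoint_inner_right L x y

lemma zne (t : ℝ) : (t : ℂ) + Complex.I ≠ 0 := by
  intro h
  have := congrArg Complex.im h
  simp at this

lemma abs_le_z (t : ℝ) : |t| ≤ ‖(t : ℂ) + Complex.I‖ := by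
  have := Complex.abs_re_le_norm ((t : ℂ) + Complex.I)
  simpa using this

lemma tend_aux (d : ℕ → ℝ) (hd : Tendsto d atTop atTop) (g b : ℕ → ℝ)
    (hg : Tendsto (fun j => g j / d j) atTop (nhds 0)) (hb : ∀ j, |b j| ≤ g j) :
    Tendsto (fun j => (b j : ℂ) * ((d j : ℂ) + Complex.I)⁻¹) atTop (nhds 0) := by
  refine squeeze_zero_norm' ?_ hg
  filter_upwards [hd.eventually_gt_atTop 0] with j hj
  rw [norm_mul, norm_inv, ← div_eq_mul_inv, Complex.norm_real, Real.norm_eq_abs]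
  have h1 := abs_le_z (d j)
  rw [abs_of_pos hj] at h1
  have h2 := hb j
  have h3 := abs_nonneg (b j)
  gcongr
  linarith

lemma exists_band (d : ℕ → ℝ) (hd : Tendsto d atTop atTop) (b : ℕ → ℝ) (l : ℕ)
    (h : Tendsto (fun j => ((if l ≤ j then |b (j - l)| else 0) + |b j|) / d j) atTop (nhds 0)) :
    ∃ K : H2 →L[ℂ] H2, IsCompactOperator K ∧ ∀ x y : H2,
      (∀ j, (x : ∀ _ : ℕ, ℂ) j = ((d j : ℂ) + Complex.I)⁻¹ * (y : ∀ _ : ℕ, ℂ) j) →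
      (∀ j, (K y : ∀ _ : ℕ, ℂ) j = (b j : ℂ) * (x : ∀ _ : ℕ, ℂ) (j + l) +
        if l ≤ j then (b (j - l) : ℂ) * (x : ∀ _ : ℕ, ℂ) (j - l) else 0) ∧
      (inner ℂ x (K y)).im = 0 := by
  obtain ⟨L, R, hL, hR, hLR⟩ := exists_shift l
  obtain ⟨P, hP, hPc⟩ := exists_diag _ (tend_aux d hd _ (fun j => if l ≤ j then b (j - l) else 0) h
    (fun j => by split_ifs <;> simp))
  obtain ⟨Q, hQ, hQc⟩ := exists_diag _ (tend_aux d hd _ b h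
    (fun j => by split_ifs <;> simp))
  refine ⟨L.comp P + R.comp Q, (hPc.clm_comp L).add (hQc.clm_comp R), fun x y hxy => ?_⟩
  have e1 : ∀ j, (L (P y) : ∀ _ : ℕ, ℂ) j = (b j : ℂ) * (x : ∀ _ : ℕ, ℂ) (j + l) := by
    intro j
    rw [hL, hP, hxy]
    simp [mul_assoc]
  have e2 : ∀ j, (Q y : ∀ _ : ℕ, ℂ) j = (b j : ℂ) * (x : ∀ _ : ℕ, ℂ) j := by
    intro j
    rw [hQ, hxy, mul_assoc]
  have e : (L.comp P + R.comp Q) y = L (P y) + R (Q y) := rfl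
  rw [e]
  constructor
  · intro j
    rw [lp.coeFn_add, Pi.add_apply, e1, hR, e2]
  · rw [inner_add_right, hLR]
    have : inner ℂ (L x) (Q y) = inner ℂ (L (P y)) x := by
      rw [lp.inner_eq_tsum, lp.inner_eq_tsum]
      refine tsum_congr fun j => ?_
      rw [e1, e2, hL]
      simp
      ring
    rw [this, ← inner_conj_symm (L (P y)) x, Complex.add_im, Complex.conj_im, add_neg_cancel]

/-- Under the relative decay condition, if additionally
`d(n) → ∞`, then the self-adjoint operator `A = D + A'` has compact resolvent:
there is a compact operator `R` on `l²` which maps into the domain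
`𝒟 = {x : Σ|d(j)x(j)|² < ∞}` and satisfies `(i + A) R y = y` for all `y`,
i.e. `R = (i + A)^{-1}`. -/
theorem compact_resolvent
    (m : ℕ) (d : ℕ → ℝ) (a : ℕ → ℕ → ℝ)
    (hsa : StandingAssumptions m d a) :
    ∃ R : lp (fun _ : ℕ => ℂ) 2 →L[ℂ] lp (fun _ : ℕ => ℂ) 2,
      IsCompactOperator R ∧
      (∀ y : lp (fun _ : ℕ => ℂ) 2,
        Memℓp (fun j => (d j : ℂ) * (R y : ∀ _ : ℕ, ℂ) j) 2) ∧
      (∀ y : lp (fun _ : ℕ => ℂ) 2, ∀ j : ℕ,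
        Complex.I * (R y : ∀ _ : ℕ, ℂ) j
          + bandOp m d a ((R y : lp (fun _ : ℕ => ℂ) 2) : ∀ _ : ℕ, ℂ) j
          = (y : ∀ _ : ℕ, ℂ) j) := by
  obtain ⟨ha, hd⟩ := hsa
  obtain ⟨T, hT, hTc⟩ := exists_diag (fun j => ((d j : ℂ) + Complex.I)⁻¹) (by
    have := tend_aux d hd (fun _ => 1) (fun _ => 1) (tendsto_const_nhds.div_atTop hd) (by simp)
    simpa using this)
  obtain ⟨E, hE, -⟩ := exists_wop (fun j => (d j : ℂ) * ((d j : ℂ) + Complex.I)⁻¹) 1 zero_le_one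
    (fun j => by
      rw [norm_mul, norm_inv, ← div_eq_mul_inv, Complex.norm_real, Real.norm_eq_abs]
      exact div_le_one_of_le₀ (abs_le_z _) (norm_nonneg _)) id Function.injective_id
  have hk : ∀ l, ∃ K : H2 →L[ℂ] H2, l ∈ Finset.Icc 1 m → (IsCompactOperator K ∧ ∀ x y : H2,
      (∀ j, (x : ∀ _ : ℕ, ℂ) j = ((d j : ℂ) + Complex.I)⁻¹ * (y : ∀ _ : ℕ, ℂ) j) →
      (∀ j, (K y : ∀ _ : ℕ, ℂ) j = (a l j : ℂ) * (x : ∀ _ : ℕ, ℂ) (j + l) +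
        if l ≤ j then (a l (j - l) : ℂ) * (x : ∀ _ : ℕ, ℂ) (j - l) else 0) ∧
      (inner ℂ x (K y)).im = 0) := by
    intro l
    by_cases hl : l ∈ Finset.Icc 1 m
    · obtain ⟨K, hK⟩ := exists_band d hd (a l) l (ha l hl)
      exact ⟨K, fun _ => hK⟩
    · exact ⟨0, fun h => absurd h hl⟩
  choose k hk using hk
  let K : H2 →L[ℂ] H2 := ∑ l ∈ Finset.Icc 1 m, k l
  have hKc : IsCompactOperator K := by
    have : K ∈ compactOperator (RingHom.id ℂ) H2 H2 :=
      Submodule.sum_mem _ fun l hl => (hk l hl).1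
    exact this
  have hKs : ∀ y, K y = ∑ l ∈ Finset.Icc 1 m, k l y := fun y => by simp [K]
  have hKv : ∀ y j, (K y : ∀ _ : ℕ, ℂ) j = offDiagOp m a (T y : ∀ _ : ℕ, ℂ) j := by
    intro y j
    rw [hKs, lp.coeFn_sum, Finset.sum_apply, offDiagOp]
    exact Finset.sum_congr rfl fun l hl => ((hk l hl).2 (T y) y (hT y)).1 j
  have hKi : ∀ y, (inner ℂ (T y) (K y)).im = 0 := by
    intro y
    rw [hKs, inner_sum, Complex.im_sum]
    exact Finset.sum_eq_zero fun l hl => ((hk l hl).2 (T y) y (hT y)).2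
  have hdec : ∀ y, y = E y + Complex.I • T y := by
    intro y
    ext j
    have : ((E y + Complex.I • T y : H2) : ∀ _ : ℕ, ℂ) j
      = (E y : ∀ _ : ℕ, ℂ) j + Complex.I * (T y : ∀ _ : ℕ, ℂ) j := rfl
    rw [this, hE, hT, ← mul_assoc, id, ← add_mul, ← add_mul, mul_inv_cancel₀ (zne _), one_mul]
  have hEi : ∀ y, (inner ℂ (T y) (E y)).im = 0 := by
    intro y
    have h1 : inner ℂ (T y) (E y) = inner ℂ (E y) (T y) := by
      rw [lp.inner_eq_tsum, lp.inner_eq_tsum]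
      refine tsum_congr fun j => ?_
      have : (E y : ∀ _ : ℕ, ℂ) j = (d j : ℂ) * (T y : ∀ _ : ℕ, ℂ) j := by
        rw [hE, hT, mul_assoc, id]
      rw [this]
      simp
      ring
    exact Complex.conj_eq_iff_im.1 (by rw [inner_conj_symm, h1])
  have hinj : ∀ y, K y = -y → y = 0 := by
    intro y hy
    have h1 := hKi y
    have h2 : inner ℂ (T y) (K y) = -(inner ℂ (T y) (E y) + Complex.I * inner ℂ (T y) (T y)) := by
      rw [hy, inner_neg_right, ← inner_smul_right, ← inner_add_right, ← hdec]
    rw [h2, inner_self_eq_norm_sq_to_K] at h1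
    have h3 : ‖T y‖ ^ 2 = 0 := by
      have := hEi y
      simp [this, ← Complex.ofReal_pow] at h1
      simp [h1]
    have h4 : T y = 0 := by simpa using h3
    ext j
    have h5 := hT y j
    rw [h4] at h5
    have : (0 : ℂ) = ((d j : ℂ) + Complex.I)⁻¹ * (y : ∀ _ : ℕ, ℂ) j := h5
    rcases mul_eq_zero.1 this.symm with h | h
    · exact absurd h (inv_ne_zero (zne _))
    · exact h
  have hres : (-1 : ℂ) ∈ resolventSet ℂ K := by
    refine (hKc.hasEigenvalue_or_mem_resolventSet (by norm_num)).resolve_left fun h => ?_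
    obtain ⟨v, hv⟩ := h.exists_hasEigenvector
    refine hv.2 (hinj v ?_)
    have := hv.apply_eq_smul
    simpa using this
  have hu : IsUnit (1 + K) := by
    have := spectrum.mem_resolventSet_iff.1 hres
    have h2 := this.neg
    convert h2 using 1
    simp
    abel
  obtain ⟨u, hu⟩ := hu
  let V : H2 →L[ℂ] H2 := ↑u⁻¹
  have hV : ∀ y, V y + K (V y) = y := by
    intro y
    have : (u : H2 →L[ℂ] H2) * V = 1 := u.mul_inv
    rw [hu] at this
    exact congrArg (fun f : H2 →L[ℂ] H2 => f y) this
  refine ⟨T.comp V, hTc.comp_clm V, fun y => ?_, fun y j => ?_⟩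
  · have : (fun j => (d j : ℂ) * (T.comp V y : ∀ _ : ℕ, ℂ) j) = (E (V y) : ∀ _ : ℕ, ℂ) := by
      funext j
      rw [hE, mul_assoc, id]
      congr 1
      exact hT _ _
    rw [this]
    exact lp.memℓp _
  · have h1 : (V y : ∀ _ : ℕ, ℂ) j + (K (V y) : ∀ _ : ℕ, ℂ) j = (y : ∀ _ : ℕ, ℂ) j :=
      congrArg (fun f : H2 => (f : ∀ _ : ℕ, ℂ) j) (hV y)
    rw [hKv] at h1
    rw [← h1, bandOp, ← add_assoc]
    congr 1
    have h2 : (T.comp V y : ∀ _ : ℕ, ℂ) j = _ := hT (V y) j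
    rw [h2, ← add_mul, add_comm, ← mul_assoc, mul_inv_cancel₀ (zne _), one_mul]
end

section
/- Let A = D + A' be a self-adjoint band operator with compact resolvent as above, with eigenvalues λ_1(A) ≤ λ_2(A) ≤ … listed in increasing order with multiplicity. If α: ℕ* → ℝ satisfies α(j) ≥ Σ_{1≤l≤m}(|a_l(j)| + |a_l(j-l)|) and α(j)/d(j) → 0, then for every n ∈ ℕ*: inf_{j≥n}(d(j) − α(j)) ≤ λ_n(A) ≤ sup_{j≤n}(d(j) + α(j)). -/
open Filter

/-- band sums -/
noncomputable def bandSum {E : Type*} [AddCommMonoid E] (m : ℕ) (f h : ℕ → ℕ → E) (j : ℕ) : E :=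
  ∑ l ∈ Finset.Icc 1 m, (f l j + if l ≤ j then h l (j - l) else 0)

lemma hasSum_shift {E : Type*} [AddCommMonoid E] [TopologicalSpace E] (f : ℕ → E) (s : E) (l : ℕ)
    (hf : HasSum f s) : HasSum (fun j => if l ≤ j then f (j - l) else 0) s := by
  have hinj : Function.Injective (fun j : ℕ => j + l) := add_left_injective l
  refine (hinj.hasSum_iff ?_).1 ?_
  · intro x hx
    rw [if_neg]
    intro hl
    exact hx ⟨x - l, Nat.sub_add_cancel hl⟩
  · simpa [Function.comp_def] using hf

lemma bandSum_transpose {E : Type*} [AddCommGroup E] [TopologicalSpace E] [IsTopologicalAddGroup E]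
    (m : ℕ) (f h : ℕ → ℕ → E)
    (hf : ∀ l ∈ Finset.Icc 1 m, Summable (f l)) (hh : ∀ l ∈ Finset.Icc 1 m, Summable (h l)) :
    ∃ s, HasSum (bandSum m f h) s ∧ HasSum (bandSum m h f) s := by
  refine ⟨∑ l ∈ Finset.Icc 1 m, (∑' j, f l j + ∑' j, h l j), ?_, ?_⟩
  · exact hasSum_sum fun l hl => (hf l hl).hasSum.add (hasSum_shift _ _ l (hh l hl).hasSum)
  · refine hasSum_sum fun l hl => ?_
    rw [add_comm]
    exact (hh l hl).hasSum.add (hasSum_shift _ _ l (hf l hl).hasSum)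

lemma bandSum_mono (m : ℕ) (f h f' h' : ℕ → ℕ → ℝ) (j : ℕ)
    (h1 : ∀ l ∈ Finset.Icc 1 m, f l j ≤ f' l j)
    (h2 : ∀ l ∈ Finset.Icc 1 m, l ≤ j → h l (j - l) ≤ h' l (j - l)) :
    bandSum m f h j ≤ bandSum m f' h' j := by
  refine Finset.sum_le_sum fun l hl => add_le_add (h1 l hl) ?_
  split_ifs with hj
  · exact h2 l hl hj
  · exact le_rfl

lemma mul_offDiag (m : ℕ) (a : ℕ → ℕ → ℝ) (z x : ℕ → ℂ) (j : ℕ) :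
    z j * offDiagOp m a x j = bandSum m (fun l j => z j * (a l j * x (j + l)))
      (fun l j => z (j + l) * (a l j * x j)) j := by
  unfold offDiagOp bandSum
  rw [Finset.mul_sum]
  refine Finset.sum_congr rfl fun l _ => ?_
  rw [mul_add]
  split_ifs with hj
  · simp only [Nat.sub_add_cancel hj]
  · simp

lemma norm_bandSum_le (m : ℕ) (f h : ℕ → ℕ → ℂ) (j : ℕ) :
    ‖bandSum m f h j‖ ≤ bandSum m (fun l j => ‖f l j‖) (fun l j => ‖h l j‖) j := by
  unfold bandSum
  refine (norm_sum_le _ _).trans (Finset.sum_le_sum fun l _ => (norm_add_le _ _).trans ?_)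
  split_ifs <;> simp

lemma summable_sq_lp (x y : lp (fun _ : ℕ => ℂ) 2) : Summable fun j => ‖x j‖ * ‖y j‖ := by
  have := (lp.summable_inner (𝕜 := ℂ) x y).norm
  simpa [mul_comm] using this

lemma edge_bound (ε R Di Dj b s t : ℝ) (hε : 0 ≤ ε) (hi : 1 ≤ Di) (hj : 1 ≤ Dj) (hR : 1 ≤ R)
    (hb : 0 ≤ b) (h1 : b ≤ ε * Di) (h2 : b ≤ ε * Dj) :
    min Dj R / Dj * (b * (s * t)) ≤ ε / 2 * (min Di R * s ^ 2 + min Dj R * t ^ 2) := by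
  set wj := min Dj R with hwj
  set wi := min Di R with hwi
  have hDj : 0 < Dj := by linarith
  have hwj1 : 1 ≤ wj := le_min hj hR
  have hwi1 : 1 ≤ wi := le_min hi hR
  have hc0 : 0 ≤ wj / Dj * b := by positivity
  have hc1 : wj / Dj * b ≤ ε * wj := by
    calc wj / Dj * b ≤ wj / Dj * (ε * Dj) := by gcongr
      _ = ε * wj := by field_simp
  have hq : wj / Dj ≤ 1 := (div_le_one hDj).2 (min_le_left _ _)
  have hc2 : wj / Dj * b ≤ ε * wi := by
    rcases le_total Di R with h | h
    · rw [hwi, min_eq_left h]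
      calc wj / Dj * b ≤ 1 * b := by gcongr
        _ ≤ _ := by linarith
    · rw [hwi, min_eq_right h]
      exact hc1.trans (mul_le_mul_of_nonneg_left (min_le_right _ _) hε)
  have hst : s * t ≤ (s ^ 2 + t ^ 2) / 2 := by nlinarith [sq_nonneg (s - t)]
  calc wj / Dj * (b * (s * t)) = (wj / Dj * b) * (s * t) := by ring
    _ ≤ (wj / Dj * b) * ((s ^ 2 + t ^ 2) / 2) := by gcongr
    _ = 1 / 2 * ((wj / Dj * b) * s ^ 2 + (wj / Dj * b) * t ^ 2) := by ring
    _ ≤ 1 / 2 * ((ε * wi) * s ^ 2 + (ε * wj) * t ^ 2) := by gcongr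
    _ = _ := by ring

lemma apriori (m : ℕ) (D : ℕ → ℝ) (a : ℕ → ℕ → ℝ) (hD : ∀ j, 1 ≤ D j) (ε : ℝ) (hε : 0 ≤ ε)
    (hεm : 2 * m * ε ≤ 1 / 2)
    (h1 : ∀ l ∈ Finset.Icc 1 m, ∀ j, |a l j| ≤ ε * D j)
    (h2 : ∀ l ∈ Finset.Icc 1 m, ∀ j, |a l j| ≤ ε * D (j + l))
    (x y : lp (fun _ : ℕ => ℂ) 2) (hxy : ∀ j, bandOp m D a x j = y j) :
    Summable fun j => D j * ‖x j‖ ^ 2 := by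
  have hQ := summable_sq_lp x y
  have hp : Summable fun j => ‖x j‖ ^ 2 := by simpa [sq] using summable_sq_lp x x
  set Q := ∑' j, ‖x j‖ * ‖y j‖ with hQdef
  have key : ∀ R, 1 ≤ R → Summable (fun j => min (D j) R * ‖x j‖ ^ 2) ∧
      ∑' j, min (D j) R * ‖x j‖ ^ 2 ≤ 2 * Q := by
    intro R hR
    have hw0 : ∀ j, 0 ≤ min (D j) R := fun j => le_min (by linarith [hD j]) (by linarith)
    have hS : Summable (fun j => min (D j) R * ‖x j‖ ^ 2) :=
      Summable.of_nonneg_of_le (fun j => mul_nonneg (hw0 j) (by positivity))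
        (fun j => mul_le_mul_of_nonneg_right (min_le_right _ _) (by positivity)) (hp.mul_left R)
    refine ⟨hS, ?_⟩
    set P : ℕ → ℝ := fun j => min (D j) R * ‖x j‖ ^ 2 with hP
    have hP0 : ∀ j, 0 ≤ P j := fun j => mul_nonneg (hw0 j) (by positivity)
    obtain ⟨s, hE, hF⟩ := bandSum_transpose m (fun l j => P (j + l)) (fun l j => P j)
      (fun l _ => (summable_nat_add_iff l).2 hS) (fun l _ => hS)
    have hFle : ∀ j, bandSum m (fun l j => P j) (fun l j => P (j + l)) j ≤ 2 * m * P j := by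
      intro j
      unfold bandSum
      calc _ ≤ ∑ l ∈ Finset.Icc 1 m, (2 * P j) := by
            refine Finset.sum_le_sum fun l _ => ?_
            split_ifs with hj
            · simp only [Nat.sub_add_cancel hj]; linarith
            · linarith [hP0 j]
        _ = _ := by simp; ring
    have hsle : s ≤ 2 * m * ∑' j, P j := by
      have := hasSum_le hFle hF (hS.hasSum.mul_left _)
      exact this
    have hterm : ∀ j, P j ≤ ‖x j‖ * ‖y j‖ + ε / 2 *
        (bandSum m (fun l j => P (j + l)) (fun l j => P j) j +
          bandSum m (fun l j => P j) (fun l j => P (j + l)) j) := by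
      intro j
      have hDj : 0 < D j := by linarith [hD j]
      have e1 : (D j : ℂ) * x j = y j - offDiagOp m a x j := by
        rw [← hxy j]; unfold bandOp; ring
      have e2 : D j * ‖x j‖ ≤ ‖y j‖ + ‖offDiagOp m a x j‖ := by
        have := norm_sub_le (y j) (offDiagOp m a x j)
        rw [← e1, norm_mul, Complex.norm_real, Real.norm_of_nonneg hDj.le] at this
        exact this
      have hq : min (D j) R / D j ≤ 1 := (div_le_one hDj).2 (min_le_left _ _)
      have hq0 : 0 ≤ min (D j) R / D j := div_nonneg (hw0 j) hDj.le
      have e3 : ‖x j‖ * ‖offDiagOp m a x j‖ ≤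
          bandSum m (fun l j => |a l j| * (‖x (j + l)‖ * ‖x j‖))
            (fun l j => |a l j| * (‖x j‖ * ‖x (j + l)‖)) j := by
        rw [← norm_mul, mul_offDiag m a x x j]
        refine (norm_bandSum_le _ _ _ _).trans (le_of_eq ?_)
        congr 1
        · funext l j; simp; ring
        · funext l j; simp; ring
      have e4 : min (D j) R / D j * bandSum m (fun l j => |a l j| * (‖x (j + l)‖ * ‖x j‖))
            (fun l j => |a l j| * (‖x j‖ * ‖x (j + l)‖)) j ≤ ε / 2 *
        (bandSum m (fun l j => P (j + l)) (fun l j => P j) j +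
          bandSum m (fun l j => P j) (fun l j => P (j + l)) j) := by
        unfold bandSum
        rw [← Finset.sum_add_distrib, Finset.mul_sum, Finset.mul_sum]
        refine Finset.sum_le_sum fun l hl => ?_
        have b1 := edge_bound ε R (D (j + l)) (D j) |a l j| ‖x (j + l)‖ ‖x j‖ hε (hD _) (hD _) hR
          (abs_nonneg _) (h2 l hl j) (h1 l hl j)
        split_ifs with hj
        · have b2 := edge_bound ε R (D (j - l)) (D j) |a l (j - l)| ‖x (j - l)‖ ‖x j‖ hε
            (hD _) (hD _) hR (abs_nonneg _) (h1 l hl _)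
            (by simpa [Nat.sub_add_cancel hj] using h2 l hl (j - l))
          simp only [Nat.sub_add_cancel hj, hP]
          nlinarith [b1, b2]
        · simp only [hP]
          nlinarith [b1]
      calc P j = min (D j) R / D j * (‖x j‖ * (D j * ‖x j‖)) := by
            simp only [hP]; field_simp
        _ ≤ min (D j) R / D j * (‖x j‖ * (‖y j‖ + ‖offDiagOp m a x j‖)) := by gcongr
        _ = min (D j) R / D j * (‖x j‖ * ‖y j‖) +
            min (D j) R / D j * (‖x j‖ * ‖offDiagOp m a x j‖) := by ring
        _ ≤ 1 * (‖x j‖ * ‖y j‖) + min (D j) R / D j *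
            bandSum m (fun l j => |a l j| * (‖x (j + l)‖ * ‖x j‖))
            (fun l j => |a l j| * (‖x j‖ * ‖x (j + l)‖)) j := by gcongr
        _ ≤ _ := by linarith [e4]
    have := hasSum_le hterm hS.hasSum (hQ.hasSum.add ((hE.add hF).mul_left (ε / 2)))
    rw [← hQdef] at this
    have hSn : 0 ≤ ∑' j, P j := tsum_nonneg hP0
    have h3 : ε * s ≤ ε * (2 * m * ∑' j, P j) := by gcongr
    have h4 : (2 * m * ε) * ∑' j, P j ≤ 1 / 2 * ∑' j, P j := by gcongr
    nlinarith
  refine summable_of_sum_le (c := 2 * Q)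
    (fun j => mul_nonneg (by linarith [hD j]) (by positivity)) fun s => ?_
  obtain ⟨hS, hle⟩ := key (1 + ∑ j ∈ s, D j)
    (by linarith [Finset.sum_nonneg (s := s) (f := D) (fun j _ => by linarith [hD j])])
  refine le_trans ?_ ((hS.sum_le_tsum s ?_).trans hle)
  · refine Finset.sum_le_sum fun j hj => ?_
    rw [min_eq_left]
    have := Finset.single_le_sum (f := D) (fun j _ => by linarith [hD j]) hj
    linarith
  · intro j _
    refine mul_nonneg (le_min (by linarith [hD j]) ?_) (by positivity)
    linarith [Finset.sum_nonneg (s := s) (f := D) (fun j _ => by linarith [hD j])]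

set_option maxHeartbeats 2000000 in
lemma form_bound (m : ℕ) (d : ℕ → ℝ) (a : ℕ → ℕ → ℝ) (α : ℕ → ℝ)
    (hα : ∀ j, (∑ l ∈ Finset.Icc 1 m, (|a l j| + if l ≤ j then |a l (j - l)| else 0)) ≤ α j)
    (x : ℕ → ℂ) (T : ℂ) (hdp : Summable fun j => d j * ‖x j‖ ^ 2)
    (hap : Summable fun j => α j * ‖x j‖ ^ 2)
    (hT : HasSum (fun j => starRingEnd ℂ (x j) * bandOp m d a x j) T) :
    ∑' j, (d j - α j) * ‖x j‖ ^ 2 ≤ T.re ∧ T.re ≤ ∑' j, (d j + α j) * ‖x j‖ ^ 2 := by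
  have hnn : ∀ j, ∀ l ∈ Finset.Icc 1 m, 0 ≤ |a l j| + if l ≤ j then |a l (j - l)| else 0 := by
    intro j l _
    split_ifs <;> positivity
  have hle : ∀ j, ∀ l ∈ Finset.Icc 1 m,
      (|a l j| + if l ≤ j then |a l (j - l)| else 0) ≤ α j := fun j l hl =>
    (Finset.single_le_sum (f := fun l => |a l j| + if l ≤ j then |a l (j - l)| else 0)
      (hnn j) hl).trans (hα j)
  have ha1 : ∀ l ∈ Finset.Icc 1 m, ∀ j, |a l j| ≤ α j := by
    intro l hl j
    refine le_trans ?_ (hle j l hl)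
    split_ifs <;> simp
  have ha2 : ∀ l ∈ Finset.Icc 1 m, ∀ j, |a l j| ≤ α (j + l) := by
    intro l hl j
    refine le_trans ?_ (hle (j + l) l hl)
    simp
  obtain ⟨s, hE, hF⟩ := bandSum_transpose m (fun l j => |a l j| * ‖x (j + l)‖ ^ 2)
    (fun l j => |a l j| * ‖x j‖ ^ 2)
    (fun l hl => Summable.of_nonneg_of_le (fun j => by positivity)
      (fun j => mul_le_mul_of_nonneg_right (ha2 l hl j) (by positivity))
      ((summable_nat_add_iff l).2 hap))
    (fun l hl => Summable.of_nonneg_of_le (fun j => by positivity)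
      (fun j => mul_le_mul_of_nonneg_right (ha1 l hl j) (by positivity)) hap)
  have hFle : ∀ j, bandSum m (fun l j => |a l j| * ‖x j‖ ^ 2)
      (fun l j => |a l j| * ‖x (j + l)‖ ^ 2) j ≤ α j * ‖x j‖ ^ 2 := by
    intro j
    refine le_trans (le_of_eq ?_) (mul_le_mul_of_nonneg_right (hα j) (by positivity))
    unfold bandSum
    rw [Finset.sum_mul]
    refine Finset.sum_congr rfl fun l _ => ?_
    split_ifs with hj
    · simp only [Nat.sub_add_cancel hj]; ring
    · ring
  have hs : s ≤ ∑' j, α j * ‖x j‖ ^ 2 := hasSum_le hFle hF hap.hasSum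
  have hre := Complex.hasSum_re hT
  have hterm : ∀ j, |(starRingEnd ℂ (x j) * bandOp m d a x j).re - d j * ‖x j‖ ^ 2| ≤ 1 / 2 *
      (bandSum m (fun l j => |a l j| * ‖x (j + l)‖ ^ 2) (fun l j => |a l j| * ‖x j‖ ^ 2) j +
       bandSum m (fun l j => |a l j| * ‖x j‖ ^ 2) (fun l j => |a l j| * ‖x (j + l)‖ ^ 2) j) := by
    intro j
    have e0 : (starRingEnd ℂ (x j) * bandOp m d a x j).re - d j * ‖x j‖ ^ 2 =
        (starRingEnd ℂ (x j) * offDiagOp m a x j).re := by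
      have : starRingEnd ℂ (x j) * bandOp m d a x j =
          ((d j * ‖x j‖ ^ 2 : ℝ) : ℂ) + starRingEnd ℂ (x j) * offDiagOp m a x j := by
        unfold bandOp
        push_cast
        rw [← Complex.conj_mul' (x j)]
        ring
      rw [this, Complex.add_re, Complex.ofReal_re]; ring
    rw [e0]
    refine (Complex.abs_re_le_norm _).trans ?_
    rw [mul_offDiag m a (fun j => starRingEnd ℂ (x j)) x j]
    refine (norm_bandSum_le _ _ _ _).trans ?_
    unfold bandSum
    rw [← Finset.sum_add_distrib, Finset.mul_sum]
    refine Finset.sum_le_sum fun l _ => ?_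
    have gen : ∀ b s t : ℝ, 0 ≤ b → s * (b * t) ≤ 1 / 2 * (b * s ^ 2 + b * t ^ 2) := by
      intro b s t hb
      nlinarith [mul_nonneg hb (sq_nonneg (s - t))]
    have b1 := gen |a l j| ‖x j‖ ‖x (j + l)‖ (abs_nonneg _)
    split_ifs with hj
    · have b2 := gen |a l (j - l)| ‖x j‖ ‖x (j - l)‖ (abs_nonneg _)
      simp only [Nat.sub_add_cancel hj, norm_mul, Complex.norm_real, Real.norm_eq_abs,
        RCLike.norm_conj]
      linarith
    · simp only [norm_mul, Complex.norm_real, Real.norm_eq_abs, RCLike.norm_conj]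
      linarith
  have hB := (hE.add hF).mul_left (1 / 2)
  have l1 := hasSum_le (fun j => (abs_le.1 (hterm j)).2) (hre.sub hdp.hasSum) hB
  have l2 := hasSum_le (fun j => (abs_le.1 (hterm j)).1) hB.neg (hre.sub hdp.hasSum)
  have t1 : ∑' j, (d j - α j) * ‖x j‖ ^ 2 = ∑' j, d j * ‖x j‖ ^ 2 - ∑' j, α j * ‖x j‖ ^ 2 := by
    rw [← hdp.tsum_sub hap]; simp only [sub_mul]
  have t2 : ∑' j, (d j + α j) * ‖x j‖ ^ 2 = ∑' j, d j * ‖x j‖ ^ 2 + ∑' j, α j * ‖x j‖ ^ 2 := by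
    rw [← hdp.tsum_add hap]; simp only [add_mul]
  rw [t1, t2]
  constructor <;> linarith

lemma exists_comb (G : ℕ → ℕ → ℂ) (n : ℕ) : ∃ c : ℕ → ℂ, (∃ i ∈ Finset.range (n + 1), c i ≠ 0) ∧
    (∀ i, n < i → c i = 0) ∧ ∀ k < n, ∑ i ∈ Finset.range (n + 1), c i * G k i = 0 := by
  let M : Matrix (Fin n) (Fin (n + 1)) ℂ := fun k i => G k i
  have hk : LinearMap.ker M.mulVecLin ≠ ⊥ :=
    LinearMap.ker_ne_bot_of_finrank_lt (by simp)
  obtain ⟨c, hc, hc0⟩ := (Submodule.ne_bot_iff _).1 hk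
  obtain ⟨i, hi⟩ := Function.ne_iff.1 hc0
  refine ⟨fun i => if h : i < n + 1 then c ⟨i, h⟩ else 0,
    ⟨i, Finset.mem_range.2 i.2, by simp only [dif_pos i.2]; exact hi⟩,
    fun i hi => dif_neg (by omega), fun k hk => ?_⟩
  have := congrFun (LinearMap.mem_ker.1 hc) ⟨k, hk⟩
  rw [Matrix.mulVecLin_apply] at this
  simp only [Matrix.mulVec, dotProduct, M, Pi.zero_apply] at this
  rw [Finset.sum_range]
  refine Eq.trans (Finset.sum_congr rfl fun i _ => ?_) this
  simp only [dif_pos i.2, mul_comm]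

lemma exists_shift_s4 (d α : ℕ → ℝ) (hd : Tendsto d atTop atTop)
    (hαd : Tendsto (fun j => α j / d j) atTop (nhds 0)) (ε : ℝ) (hε : 0 < ε) :
    ∃ M : ℝ, ∀ j, 1 ≤ d j + M ∧ α j ≤ ε * (d j + M) := by
  obtain ⟨N, hN⟩ := eventually_atTop.1 ((hd.eventually_ge_atTop 1).and
    (hαd.eventually_le_const hε))
  have hnn : ∀ j ∈ Finset.range N, 0 ≤ |d j| + 1 + |α j| / ε := fun j _ => by positivity
  refine ⟨∑ j ∈ Finset.range N, (|d j| + 1 + |α j| / ε), fun j => ?_⟩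
  have hM := Finset.sum_nonneg hnn
  set M := ∑ j ∈ Finset.range N, (|d j| + 1 + |α j| / ε)
  rcases lt_or_ge j N with h | h
  · have h1 : |d j| + 1 + |α j| / ε ≤ M :=
      Finset.single_le_sum (f := fun j => |d j| + 1 + |α j| / ε) hnn (Finset.mem_range.2 h)
    have h2 : 0 ≤ |α j| / ε := by positivity
    have h3 := neg_abs_le (d j)
    refine ⟨by linarith, (le_abs_self _).trans ?_⟩
    rw [← div_le_iff₀' hε]
    linarith
  · obtain ⟨h1, h2⟩ := hN j h
    rw [div_le_iff₀ (by linarith)] at h2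
    exact ⟨by linarith, h2.trans (by gcongr; linarith)⟩

lemma exists_lp (f : ℕ → ℂ) (N : ℕ) (hf : ∀ j, N < j → f j = 0) :
    ∃ x : lp (fun _ : ℕ => ℂ) 2, ∀ j, x j = f j := by
  refine ⟨⟨f, memℓp_gen (summable_of_ne_finset_zero (s := Finset.range (N + 1)) ?_)⟩, fun j => rfl⟩
  intro j hj
  rw [hf j (by simpa using hj)]
  simp

lemma lp_norm_sq (x : lp (fun _ : ℕ => ℂ) 2) : HasSum (fun j => ‖x j‖ ^ 2) (‖x‖ ^ 2) := by
  have := Complex.hasSum_re (lp.hasSum_inner (𝕜 := ℂ) x x)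
  rw [inner_self_eq_norm_sq_to_K] at this
  convert this using 1
  · funext j
    rw [inner_self_eq_norm_sq_to_K]
    norm_cast
  · norm_cast

lemma symm_band (m : ℕ) (d : ℕ → ℝ) (a : ℕ → ℕ → ℝ) (z x : ℕ → ℂ) (N : ℕ)
    (hx : ∀ j, N < j → x j = 0) (μ : ℝ) (hz : ∀ j, bandOp m d a z j = μ * z j) (S T : ℂ)
    (hS : HasSum (fun j => starRingEnd ℂ (z j) * x j) S)
    (hT : HasSum (fun j => starRingEnd ℂ (z j) * bandOp m d a x j) T) : T = μ * S := by
  have fs : ∀ f : ℕ → ℂ, (∀ j, N < j → f j = 0) → Summable f := fun f hf =>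
    summable_of_ne_finset_zero (s := Finset.range (N + 1)) fun j hj => hf j (by simpa using hj)
  obtain ⟨s, hE, hF⟩ := bandSum_transpose m
    (fun l j => starRingEnd ℂ (z j) * (a l j * x (j + l)))
    (fun l j => starRingEnd ℂ (z (j + l)) * (a l j * x j))
    (fun l _ => fs _ fun j hj => by rw [hx (j + l) (by omega)]; simp)
    (fun l _ => fs _ fun j hj => by rw [hx j hj]; simp)
  have hD : Summable fun j => (d j : ℂ) * (starRingEnd ℂ (z j) * x j) :=
    fs _ fun j hj => by rw [hx j hj]; simp
  have h1 := hD.hasSum.add hE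
  have h2 := hD.hasSum.add hF
  have e1 : T = ∑' j, (d j : ℂ) * (starRingEnd ℂ (z j) * x j) + s := by
    refine hT.unique (h1.congr_fun fun j => ?_)
    rw [← mul_offDiag m a (fun j => starRingEnd ℂ (z j)) x j]
    unfold bandOp; ring
  have e2 : μ * S = ∑' j, (d j : ℂ) * (starRingEnd ℂ (z j) * x j) + s := by
    refine (hS.mul_left (μ : ℂ)).unique (h2.congr_fun fun j => ?_)
    have : bandSum m (fun l j => starRingEnd ℂ (z (j + l)) * (a l j * x j))
        (fun l j => starRingEnd ℂ (z j) * (a l j * x (j + l))) j =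
        x j * offDiagOp m a (fun j => starRingEnd ℂ (z j)) j := by
      rw [mul_offDiag]
      congr 1
      · funext l j; ring
      · funext l j; ring
    rw [this]
    have h3 : offDiagOp m a (fun j => starRingEnd ℂ (z j)) j = starRingEnd ℂ (offDiagOp m a z j) := by
      unfold offDiagOp
      rw [map_sum]
      refine Finset.sum_congr rfl fun l _ => ?_
      split_ifs <;> simp
    rw [h3]
    have h4 := congrArg (starRingEnd ℂ) (hz j)
    unfold bandOp at h4
    simp only [map_add, map_mul, Complex.conj_ofReal] at h4
    rw [← mul_assoc, ← h4]; ring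
  rw [e1, e2]

lemma upper_bound (m : ℕ) (d : ℕ → ℝ) (a : ℕ → ℕ → ℝ) (α : ℕ → ℝ)
    (lam : ℕ → ℝ) (v : ℕ → lp (fun _ : ℕ => ℂ) 2)
    (heig : IsEigenSystem m d a lam v)
    (hα : ∀ j, (∑ l ∈ Finset.Icc 1 m, (|a l j| + if l ≤ j then |a l (j - l)| else 0)) ≤ α j)
    (n : ℕ) (B : ℝ) (hB : ∀ j ≤ n, d j + α j ≤ B) : lam n ≤ B := by
  obtain ⟨ho, hsp, hmono, -, hev⟩ := heig
  obtain ⟨c, ⟨i₀, hi₀, hci₀⟩, hc0, hck⟩ := exists_comb (fun k i => starRingEnd ℂ (v k i)) n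
  obtain ⟨x, hx⟩ := exists_lp c n hc0
  have hxf : (x : ∀ _ : ℕ, ℂ) = c := funext hx
  have hband0 : ∀ j, n + m < j → bandOp m d a c j = 0 := by
    intro j hj
    unfold bandOp offDiagOp
    rw [hc0 j (by omega), mul_zero, zero_add]
    refine Finset.sum_eq_zero fun l hl => ?_
    rw [Finset.mem_Icc] at hl
    rw [hc0 (j + l) (by omega), hc0 (j - l) (by omega)]
    simp
  obtain ⟨y, hy⟩ := exists_lp (bandOp m d a c) (n + m) hband0
  have hvx : ∀ k, HasSum (fun j => starRingEnd ℂ (v k j) * c j) (inner ℂ (v k) x) := by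
    intro k
    refine (lp.hasSum_inner (𝕜 := ℂ) (v k) x).congr_fun fun j => ?_
    rw [hx j, RCLike.inner_apply, mul_comm]
  have hvy : ∀ k, HasSum (fun j => starRingEnd ℂ (v k j) * bandOp m d a c j)
      (inner ℂ (v k) y) := by
    intro k
    refine (lp.hasSum_inner (𝕜 := ℂ) (v k) y).congr_fun fun j => ?_
    rw [hy j, RCLike.inner_apply, mul_comm]
  have hsym : ∀ k, inner ℂ (v k) y = lam k * inner ℂ (v k) x := fun k =>
    symm_band m d a (v k) c n hc0 (lam k) (hev k) _ _ (hvx k) (hvy k)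
  have hzero : ∀ k < n, inner ℂ (v k) x = 0 := by
    intro k hk
    rw [← hck k hk]
    refine (hvx k).unique ?_
    have := hasSum_sum_of_ne_finset_zero (L := SummationFilter.unconditional ℕ) (f := fun j => starRingEnd ℂ (v k j) * c j)
      (s := Finset.range (n + 1)) (fun j hj => by rw [hc0 j (by simpa using hj)]; simp)
    simpa only [mul_comm] using this
  let b : HilbertBasis ℕ ℂ (lp (fun _ : ℕ => ℂ) 2) := HilbertBasis.mk ho hsp.ge
  have hb : ∀ k, b k = v k := fun k => by simp [b]
  have hprod : ∀ k, inner ℂ x (v k) * inner ℂ (v k) x = ((‖inner ℂ (v k) x‖ ^ 2 : ℝ) : ℂ) := by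
    intro k
    rw [← inner_conj_symm x (v k), Complex.conj_mul']
    push_cast; rfl
  have s1 : HasSum (fun k => ‖inner ℂ (v k) x‖ ^ 2) (‖x‖ ^ 2) := by
    have := Complex.hasSum_re (b.hasSum_inner_mul_inner x x)
    simp only [hb, hprod, Complex.ofReal_re] at this
    rw [inner_self_eq_norm_sq_to_K] at this
    convert this using 1
    norm_cast
  have s2 : HasSum (fun k => lam k * ‖inner ℂ (v k) x‖ ^ 2) (inner ℂ x y).re := by
    have := Complex.hasSum_re (b.hasSum_inner_mul_inner x y)
    refine this.congr_fun fun k => ?_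
    rw [hb, hsym, mul_left_comm, hprod, ← Complex.ofReal_mul, Complex.ofReal_re]
  have l1 : lam n * ‖x‖ ^ 2 ≤ (inner ℂ x y).re := by
    refine hasSum_le (fun k => ?_) (s1.mul_left (lam n)) s2
    rcases lt_or_ge k n with h | h
    · simp [hzero k h]
    · exact mul_le_mul_of_nonneg_right (hmono h) (by positivity)
  have fs : ∀ f : ℕ → ℝ, Summable fun j => f j * ‖c j‖ ^ 2 := fun f =>
    summable_of_ne_finset_zero (s := Finset.range (n + 1)) fun j hj => by
      rw [hc0 j (by simpa using hj)]; simp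
  have l2 := (form_bound m d a α hα c (inner ℂ x y) (fs d) (fs α) (by
    refine (lp.hasSum_inner (𝕜 := ℂ) x y).congr_fun fun j => ?_
    rw [hx j, hy j, RCLike.inner_apply, mul_comm])).2
  have hn := lp_norm_sq x
  simp only [hx] at hn
  have l3 : ∑' j, (d j + α j) * ‖c j‖ ^ 2 ≤ B * ‖x‖ ^ 2 := by
    refine hasSum_le (fun j => ?_) (fs fun j => d j + α j).hasSum (hn.mul_left B)
    rcases le_or_gt j n with h | h
    · exact mul_le_mul_of_nonneg_right (hB j h) (by positivity)
    · simp [hc0 j h]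
  have hpos : 0 < ‖x‖ ^ 2 := by
    have : x ≠ 0 := by
      rintro rfl
      exact hci₀ (by rw [← hx i₀]; rfl)
    positivity
  exact le_of_mul_le_mul_right (by linarith) hpos

lemma bandOp_sum (m : ℕ) (d : ℕ → ℝ) (a : ℕ → ℕ → ℝ) (s : Finset ℕ) (c : ℕ → ℂ)
    (u : ℕ → ℕ → ℂ) (j : ℕ) : bandOp m d a (fun j => ∑ i ∈ s, c i * u i j) j =
      ∑ i ∈ s, c i * bandOp m d a (u i) j := by
  unfold bandOp offDiagOp
  simp only [mul_add, Finset.sum_add_distrib, Finset.mul_sum]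
  congr 1
  · exact Finset.sum_congr rfl fun i _ => by ring
  · congr 1
    · rw [Finset.sum_comm]
      exact Finset.sum_congr rfl fun i _ => Finset.sum_congr rfl fun l _ => by ring
    · rw [Finset.sum_comm]
      refine Finset.sum_congr rfl fun l _ => ?_
      split_ifs
      · exact Finset.sum_congr rfl fun i _ => by ring
      · simp

lemma lower_bound (m : ℕ) (d : ℕ → ℝ) (a : ℕ → ℕ → ℝ) (α : ℕ → ℝ)
    (lam : ℕ → ℝ) (v : ℕ → lp (fun _ : ℕ => ℂ) 2)
    (heig : IsEigenSystem m d a lam v)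
    (hα : ∀ j, (∑ l ∈ Finset.Icc 1 m, (|a l j| + if l ≤ j then |a l (j - l)| else 0)) ≤ α j)
    (M : ℝ) (hM : ∀ j, 1 ≤ d j + M ∧ α j ≤ 1 / (4 * m + 4) * (d j + M))
    (n : ℕ) (B : ℝ) (hB : ∀ j, n ≤ j → B ≤ d j - α j) : B ≤ lam n := by
  obtain ⟨ho, hsp, hmono, -, hev⟩ := heig
  obtain ⟨c, ⟨i₀, hi₀, hci₀⟩, hc0, hck⟩ := exists_comb (fun k i => v i k) n
  have hcoe : ∀ (e : ℕ → ℂ) (j : ℕ), (∑ i ∈ Finset.range (n + 1), e i • v i :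
      lp (fun _ : ℕ => ℂ) 2) j = ∑ i ∈ Finset.range (n + 1), e i * v i j := by
    intro e j
    rw [lp.coeFn_sum, Finset.sum_apply]
    rfl
  obtain ⟨x, hx⟩ : ∃ x, x = ∑ i ∈ Finset.range (n + 1), c i • v i := ⟨_, rfl⟩
  obtain ⟨y, hy⟩ : ∃ y, y = ∑ i ∈ Finset.range (n + 1), (c i * lam i) • v i := ⟨_, rfl⟩
  have hxj : ∀ j, x j = ∑ i ∈ Finset.range (n + 1), c i * v i j := fun j => by rw [hx]; exact hcoe c j
  have hyj : ∀ j, y j = ∑ i ∈ Finset.range (n + 1), (c i * lam i) * v i j := fun j => by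
    rw [hy]; exact hcoe (fun i => c i * lam i) j
  have hx0 : ∀ j < n, x j = 0 := fun j hj => by rw [hxj, hck j hj]
  have hband : ∀ j, bandOp m d a x j = y j := by
    intro j
    have : (x : ∀ _ : ℕ, ℂ) = fun j => ∑ i ∈ Finset.range (n + 1), c i * v i j := funext hxj
    rw [this, bandOp_sum m d a _ c (fun i => v i) j, hyj]
    exact Finset.sum_congr rfl fun i _ => by rw [hev]; ring
  have hnorm : ‖x‖ ^ 2 = ∑ i ∈ Finset.range (n + 1), ‖c i‖ ^ 2 := by
    have h1 : inner ℂ x x = ((∑ i ∈ Finset.range (n + 1), ‖c i‖ ^ 2 : ℝ) : ℂ) := by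
      conv_lhs => rw [hx]
      rw [ho.inner_sum]
      push_cast
      exact Finset.sum_congr rfl fun i _ => Complex.conj_mul' _
    rw [inner_self_eq_norm_sq_to_K] at h1
    exact Complex.ofReal_injective (by rw [← h1]; push_cast; rfl)
  have hin : (inner ℂ x y).re = ∑ i ∈ Finset.range (n + 1), lam i * ‖c i‖ ^ 2 := by
    have h1 : inner ℂ x y = ((∑ i ∈ Finset.range (n + 1), lam i * ‖c i‖ ^ 2 : ℝ) : ℂ) := by
      rw [hx, hy, ho.inner_sum]
      push_cast
      exact Finset.sum_congr rfl fun i _ => by rw [← mul_assoc, Complex.conj_mul', mul_comm]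
    rw [h1, Complex.ofReal_re]
  have l1 : (inner ℂ x y).re ≤ lam n * ‖x‖ ^ 2 := by
    rw [hin, hnorm, Finset.mul_sum]
    refine Finset.sum_le_sum fun i hi => ?_
    rw [Finset.mem_range] at hi
    exact mul_le_mul_of_nonneg_right (hmono (by omega)) (by positivity)
  have hpos : 0 < ‖x‖ ^ 2 := by
    rw [hnorm]
    refine Finset.sum_pos' (fun i _ => by positivity) ⟨i₀, hi₀, by positivity⟩
  have hnn : ∀ j, ∀ l ∈ Finset.Icc 1 m, 0 ≤ |a l j| + if l ≤ j then |a l (j - l)| else 0 := by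
    intro j l _
    split_ifs <;> positivity
  have hle : ∀ j, ∀ l ∈ Finset.Icc 1 m,
      (|a l j| + if l ≤ j then |a l (j - l)| else 0) ≤ α j := fun j l hl =>
    (Finset.single_le_sum (f := fun l => |a l j| + if l ≤ j then |a l (j - l)| else 0)
      (hnn j) hl).trans (hα j)
  have hα0 : ∀ j, 0 ≤ α j := fun j => (Finset.sum_nonneg (hnn j)).trans (hα j)
  have hp : Summable fun j => ‖x j‖ ^ 2 := (lp_norm_sq x).summable
  have hDp : Summable fun j => (d j + M) * ‖x j‖ ^ 2 := by
    refine apriori m (fun j => d j + M) a (fun j => (hM j).1) (1 / (4 * m + 4)) (by positivity)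
      ?_ ?_ ?_ x (y + (M : ℂ) • x) ?_
    · rw [mul_one_div, div_le_div_iff₀ (by positivity) (by norm_num)]
      linarith
    · intro l hl j
      refine le_trans ?_ ((hle j l hl).trans (hM j).2)
      split_ifs <;> simp
    · intro l hl j
      refine le_trans ?_ ((hle (j + l) l hl).trans (hM (j + l)).2)
      simp
    · intro j
      have : (y + (M : ℂ) • x : lp (fun _ : ℕ => ℂ) 2) j = y j + (M : ℂ) * x j := rfl
      rw [this, ← hband j]
      unfold bandOp
      push_cast; ring
  have hdp : Summable fun j => d j * ‖x j‖ ^ 2 :=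
    (hDp.sub (hp.mul_left M)).congr fun j => by ring
  have hap : Summable fun j => α j * ‖x j‖ ^ 2 :=
    Summable.of_nonneg_of_le (fun j => mul_nonneg (hα0 j) (by positivity))
      (fun j => by
        have := mul_le_mul_of_nonneg_right (hM j).2 (sq_nonneg ‖x j‖)
        rwa [mul_assoc] at this) (hDp.mul_left (1 / (4 * m + 4) : ℝ))
  have l2 := (form_bound m d a α hα x (inner ℂ x y) hdp hap (by
    refine (lp.hasSum_inner (𝕜 := ℂ) x y).congr_fun fun j => ?_
    rw [hband j, RCLike.inner_apply, mul_comm])).1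
  have l3 : B * ‖x‖ ^ 2 ≤ ∑' j, (d j - α j) * ‖x j‖ ^ 2 := by
    refine hasSum_le (fun j => ?_) ((lp_norm_sq x).mul_left B)
      ((hdp.sub hap).congr fun j => by ring).hasSum
    rcases lt_or_ge j n with h | h
    · simp [hx0 j h]
    · exact mul_le_mul_of_nonneg_right (hB j h) (by positivity)
  exact le_of_mul_le_mul_right (by linarith) hpos

/-- If `α(j) ≥ Σ_{1≤l≤m}(|a_l(j)| + |a_l(j-l)|)` and
`α(j)/d(j) → 0`, then for every `n`:
`inf_{j≥n}(d(j) − α(j)) ≤ λ_n(A) ≤ sup_{j≤n}(d(j) + α(j))`. -/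
theorem minmax_eigenvalue_bounds
    (m : ℕ) (d : ℕ → ℝ) (a : ℕ → ℕ → ℝ) (α : ℕ → ℝ)
    (hsa : StandingAssumptions m d a)
    (lam : ℕ → ℝ) (v : ℕ → lp (fun _ : ℕ => ℂ) 2)
    (heig : IsEigenSystem m d a lam v)
    (hα : ∀ j, (∑ l ∈ Finset.Icc 1 m, (|a l j| + if l ≤ j then |a l (j - l)| else 0)) ≤ α j)
    (hαd : Tendsto (fun j => α j / d j) atTop (nhds 0)) :
    ∀ n : ℕ, sInf {r : ℝ | ∃ j ≥ n, r = d j - α j} ≤ lam n ∧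
      lam n ≤ sSup {r : ℝ | ∃ j ≤ n, r = d j + α j} := by
  obtain ⟨M, hM⟩ := exists_shift_s4 d α hsa.2 hαd (1 / (4 * m + 4)) (by positivity)
  intro n
  constructor
  · refine lower_bound m d a α lam v heig hα M hM n _ fun j hj => csInf_le ?_ ⟨j, hj, rfl⟩
    refine ⟨-M, ?_⟩
    rintro r ⟨j, -, rfl⟩
    obtain ⟨h1, h2⟩ := hM j
    have h3 : (1 / (4 * m + 4) : ℝ) ≤ 1 := by
      rw [div_le_one (by positivity)]
      have : (0 : ℝ) ≤ m := by positivity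
      linarith
    have h4 := mul_le_mul_of_nonneg_right h3 (by linarith : 0 ≤ d j + M)
    linarith
  · refine upper_bound m d a α lam v heig hα n _ fun j hj => le_csSup ?_ ⟨j, hj, rfl⟩
    have : {r : ℝ | ∃ j ≤ n, r = d j + α j} = (fun j => d j + α j) '' (Set.Iic n) := by
      ext r; simp [eq_comm]
    rw [this]
    exact ((Set.finite_Iic n).image _).bddAbove
end

section
/- Let A = D + A' be as above. Assume there exist C > 0, δ ∈ ℝ, κ > 0 with δ + κ > 0, and n₀ such that d(n+1) − d(n) ≥ C^{-1} n^{δ+κ−1} for n > n₀, and a_l(n) = O(n^δ) as n → ∞ for each l = 1,…,m. Then λ_n(A) = d(n) + O(n^δ) as n → ∞. -/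
open Filter

namespace BandAux

noncomputable def wt (m : ℕ) (a : ℕ → ℕ → ℝ) (j : ℕ) : ℝ :=
  ∑ l ∈ Finset.Icc 1 m, (|a l j| + if l ≤ j then |a l (j - l)| else 0)

lemma hasSum_shift {E : Type*} [AddCommMonoid E] [TopologicalSpace E] (F : ℕ → E) (l : ℕ) (s : E) :
    HasSum (fun j => if l ≤ j then F (j - l) else 0) s ↔ HasSum F s := by
  have h := Function.Injective.hasSum_iff (f := fun j => if l ≤ j then F (j - l) else 0)
    (a := s) (add_left_injective l) (by
      intro x hx
      have : ¬ l ≤ x := fun h => hx ⟨x - l, by simp [h]⟩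
      simp [this])
  rw [← h]
  have : ((fun j => if l ≤ j then F (j - l) else 0) ∘ fun x => x + l) = F := by
    funext j; simp
  rw [this]

lemma wt_nonneg (m : ℕ) (a : ℕ → ℕ → ℝ) (j : ℕ) : 0 ≤ wt m a j := by
  unfold wt
  refine Finset.sum_nonneg fun l _ => ?_
  split_ifs <;> positivity

lemma off_form (m : ℕ) (a : ℕ → ℕ → ℝ) (x : ℕ → ℂ)
    (hw : Summable fun j => wt m a j * ‖x j‖ ^ 2) :
    ∃ s : ℂ, HasSum (fun j => offDiagOp m a x j * starRingEnd ℂ (x j)) s ∧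
      ‖s‖ ≤ ∑' j, wt m a j * ‖x j‖ ^ 2 := by
  have key : ∀ l ∈ Finset.Icc 1 m, ∃ S1 S2 : ℝ,
      HasSum (fun j => |a l j| * ‖x j‖ ^ 2) S1 ∧
      HasSum (fun j => if l ≤ j then |a l (j - l)| * ‖x j‖ ^ 2 else 0) S2 ∧
      HasSum (fun j => |a l j| * ‖x (j + l)‖ ^ 2) S2 ∧
      HasSum (fun j => if l ≤ j then |a l (j - l)| * ‖x (j - l)‖ ^ 2 else 0) S1 := by
    intro l hl
    have hle : ∀ j, |a l j| + (if l ≤ j then |a l (j - l)| else 0) ≤ wt m a j := by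
      intro j
      unfold wt
      refine Finset.single_le_sum (f := fun l => |a l j| + (if l ≤ j then |a l (j - l)| else 0))
        (fun l _ => ?_) hl
      split_ifs <;> positivity
    have s1 : Summable (fun j => |a l j| * ‖x j‖ ^ 2) := by
      refine Summable.of_nonneg_of_le (fun j => by positivity) (fun j => ?_) hw
      refine mul_le_mul_of_nonneg_right ?_ (by positivity)
      refine le_trans ?_ (hle j)
      split_ifs <;> simp
    have s2 : Summable (fun j => if l ≤ j then |a l (j - l)| * ‖x j‖ ^ 2 else 0) := by
      refine Summable.of_nonneg_of_le (fun j => by split_ifs <;> positivity) (fun j => ?_) hw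
      have := hle j
      split_ifs with h
      · refine mul_le_mul_of_nonneg_right ?_ (by positivity)
        simp only [h, if_true] at this
        linarith [abs_nonneg (a l j)]
      · exact mul_nonneg (wt_nonneg _ _ _) (by positivity)
    refine ⟨_, _, s1.hasSum, s2.hasSum, ?_, ?_⟩
    · rw [← hasSum_shift _ l]
      convert s2.hasSum using 2 with j
      split_ifs with h
      · rw [Nat.sub_add_cancel h]
      · rfl
    · exact (hasSum_shift (fun j => |a l j| * ‖x j‖ ^ 2) l _).2 s1.hasSum
  choose! S1 S2 h1 h2 h3 h4 using key
  have hB : HasSum (fun j => ∑ l ∈ Finset.Icc 1 m,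
      (1/2 * (|a l j| * ‖x j‖ ^ 2 + |a l j| * ‖x (j + l)‖ ^ 2) +
       1/2 * ((if l ≤ j then |a l (j - l)| * ‖x j‖ ^ 2 else 0) +
        (if l ≤ j then |a l (j - l)| * ‖x (j - l)‖ ^ 2 else 0))))
      (∑ l ∈ Finset.Icc 1 m, (1/2 * (S1 l + S2 l) + 1/2 * (S2 l + S1 l))) :=
    hasSum_sum fun l hl => (((h1 l hl).add (h3 l hl)).mul_left _).add
      (((h2 l hl).add (h4 l hl)).mul_left _)
  have hW : HasSum (fun j => wt m a j * ‖x j‖ ^ 2) (∑ l ∈ Finset.Icc 1 m, (S1 l + S2 l)) := by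
    have : HasSum (fun j => ∑ l ∈ Finset.Icc 1 m, (|a l j| * ‖x j‖ ^ 2 +
      (if l ≤ j then |a l (j - l)| * ‖x j‖ ^ 2 else 0))) (∑ l ∈ Finset.Icc 1 m, (S1 l + S2 l)) :=
      hasSum_sum fun l hl => (h1 l hl).add (h2 l hl)
    convert this using 2 with j
    unfold wt
    rw [Finset.sum_mul]
    refine Finset.sum_congr rfl fun l _ => ?_
    split_ifs <;> ring
  have hle : ∀ j, ‖offDiagOp m a x j * starRingEnd ℂ (x j)‖ ≤ ∑ l ∈ Finset.Icc 1 m,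
      (1/2 * (|a l j| * ‖x j‖ ^ 2 + |a l j| * ‖x (j + l)‖ ^ 2) +
       1/2 * ((if l ≤ j then |a l (j - l)| * ‖x j‖ ^ 2 else 0) +
        (if l ≤ j then |a l (j - l)| * ‖x (j - l)‖ ^ 2 else 0))) := by
    intro j
    unfold offDiagOp
    rw [Finset.sum_mul]
    refine (norm_sum_le _ _).trans (Finset.sum_le_sum fun l _ => ?_)
    rw [add_mul]
    refine (norm_add_le _ _).trans (add_le_add ?_ ?_)
    · simp only [norm_mul, RCLike.norm_conj, Complex.norm_real, Real.norm_eq_abs]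
      have := mul_nonneg (abs_nonneg (a l j)) (sq_nonneg (‖x j‖ - ‖x (j + l)‖))
      nlinarith
    · split_ifs with h
      · simp only [norm_mul, RCLike.norm_conj, Complex.norm_real, Real.norm_eq_abs]
        have := mul_nonneg (abs_nonneg (a l (j - l))) (sq_nonneg (‖x j‖ - ‖x (j - l)‖))
        nlinarith
      · simp
  have hs : Summable (fun j => offDiagOp m a x j * starRingEnd ℂ (x j)) :=
    Summable.of_norm_bounded hB.summable hle
  refine ⟨_, hs.hasSum, ?_⟩
  rw [hW.tsum_eq]
  refine (tsum_of_norm_bounded hB hle).trans (le_of_eq ?_)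
  refine Finset.sum_congr rfl fun l _ => by ring

lemma symm_form (m : ℕ) (d : ℕ → ℝ) (a : ℕ → ℕ → ℝ) (v x : ℕ → ℂ) (n : ℕ)
    (hx : ∀ j, n < j → x j = 0) :
    ∃ s : ℂ, HasSum (fun j => bandOp m d a x j * starRingEnd ℂ (v j)) s ∧
      HasSum (fun j => x j * starRingEnd ℂ (bandOp m d a v j)) s := by
  have hF : ∀ l, Summable (fun j => (a l j : ℂ) * x (j + l) * starRingEnd ℂ (v j)) := by
    intro l
    refine summable_of_ne_finset_zero (s := Finset.range (n+1)) fun j hj => ?_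
    rw [hx (j + l) (by simp at hj; omega)]; simp
  have hF' : ∀ l, Summable (fun j => (a l j : ℂ) * x j * starRingEnd ℂ (v (j + l))) := by
    intro l
    refine summable_of_ne_finset_zero (s := Finset.range (n+1)) fun j hj => ?_
    rw [hx j (by simp at hj; omega)]; simp
  have hD : Summable (fun j => (d j : ℂ) * x j * starRingEnd ℂ (v j)) := by
    refine summable_of_ne_finset_zero (s := Finset.range (n+1)) fun j hj => ?_
    rw [hx j (by simp at hj; omega)]; simp
  refine ⟨(∑' j, (d j : ℂ) * x j * starRingEnd ℂ (v j)) + ∑ l ∈ Finset.Icc 1 m,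
    ((∑' j, (a l j : ℂ) * x j * starRingEnd ℂ (v (j + l))) +
      ∑' j, (a l j : ℂ) * x (j + l) * starRingEnd ℂ (v j)), ?_, ?_⟩
  rotate_left
  · have := hD.hasSum.add (hasSum_sum (s := Finset.Icc 1 m) fun l _ =>
      (hF' l).hasSum.add ((hasSum_shift _ l _).2 (hF l).hasSum))
    convert this using 2 with j
    unfold bandOp offDiagOp
    simp only [map_add, map_mul, map_sum, mul_add, Finset.mul_sum, Complex.conj_ofReal]
    congr 1
    · ring
    · refine Finset.sum_congr rfl fun l _ => ?_
      congr 1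
      · ring
      · split_ifs with h
        · rw [Nat.sub_add_cancel h, map_mul, Complex.conj_ofReal]; ring
        · simp
  · have := hD.hasSum.add (hasSum_sum (s := Finset.Icc 1 m) fun l _ =>
      (hF l).hasSum.add ((hasSum_shift _ l _).2 (hF' l).hasSum))
    convert this using 2 with j
    · unfold bandOp offDiagOp
      simp only [add_mul, Finset.sum_mul]
      congr 1
      refine Finset.sum_congr rfl fun l _ => ?_
      congr 1
      split_ifs with h
      · rw [Nat.sub_add_cancel h]
      · simp
    · refine Finset.sum_congr rfl fun l _ => ?_
      rw [add_comm]

lemma p_bound (m : ℕ) (ε : ℝ) (hε : ε * (2 * m) ≤ 1 / 2) (p h : ℕ → ℝ)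
    (hp0 : ∀ j, 0 ≤ p j)
    (hp : Summable p) (hh : Summable h)
    (hle : ∀ j, p j ≤ h j + ε * ∑ l ∈ Finset.Icc 1 m,
      (p j + (1/2 * p (j + l) + 1/2 * if l ≤ j then p (j - l) else 0))) :
    ∑' j, p j ≤ 2 * ∑' j, h j := by
  set S := ∑' j, p j with hS
  have hS0 : 0 ≤ S := tsum_nonneg hp0
  have h1 : ∀ l, HasSum (fun j => if l ≤ j then p (j - l) else 0) S := fun l =>
    (hasSum_shift _ l _).2 hp.hasSum
  have h2 : ∀ l, Summable (fun j => p (j + l)) := fun l => (summable_nat_add_iff l).2 hp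
  have h3 : ∀ l, ∑' j, p (j + l) ≤ S := by
    intro l
    have := hp.sum_add_tsum_nat_add l
    have h0 : 0 ≤ ∑ i ∈ Finset.range l, p i := Finset.sum_nonneg fun i _ => hp0 i
    linarith
  by_cases hε0 : ε ≤ 0
  · have : S ≤ ∑' j, h j := by
      refine hp.tsum_le_tsum (fun j => (hle j).trans ?_) hh
      have : 0 ≤ ∑ l ∈ Finset.Icc 1 m,
        (p j + (1/2 * p (j + l) + 1/2 * if l ≤ j then p (j - l) else 0)) := by
        refine Finset.sum_nonneg fun l _ => ?_
        have := hp0 j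
        have := hp0 (j + l)
        have := hp0 (j - l)
        split_ifs <;> linarith
      nlinarith
    linarith
  · push Not at hε0
    have hR := hh.hasSum.add ((hasSum_sum (s := Finset.Icc 1 m) fun l _ =>
      hp.hasSum.add (((h2 l).hasSum.mul_left (1/2)).add ((h1 l).mul_left (1/2)))).mul_left ε)
    have hS2 := hasSum_le hle hp.hasSum hR
    have : ∑ l ∈ Finset.Icc 1 m, (S + (1/2 * (∑' j, p (j + l)) + 1/2 * S)) ≤ (m : ℝ) * (2 * S) := by
      refine (Finset.sum_le_card_nsmul _ _ (2 * S) fun l _ => ?_).trans ?_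
      · have := h3 l; linarith
      · simp
    have h5 := mul_le_mul_of_nonneg_left this hε0.le
    have h6 := mul_le_mul_of_nonneg_right hε hS0
    rw [← hS] at hS2
    linarith

lemma exists_combo {E : Type*} [AddCommGroup E] [Module ℂ E] (n : ℕ) (u : ℕ → E)
    (f : ℕ → E →ₗ[ℂ] ℂ) : ∃ c : Fin (n+1) → ℂ, c ≠ 0 ∧
      ∀ k, k < n → f k (∑ i : Fin (n+1), c i • u i) = 0 := by
  let T : (Fin (n+1) → ℂ) →ₗ[ℂ] (Fin n → ℂ) :=
    LinearMap.pi fun k => (f k) ∘ₗ (Fintype.linearCombination ℂ (fun i : Fin (n+1) => u i))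
  have hT : LinearMap.ker T ≠ ⊥ := LinearMap.ker_ne_bot_of_finrank_lt (by simp)
  obtain ⟨c, hc, hc0⟩ := (Submodule.ne_bot_iff _).1 hT
  refine ⟨c, hc0, fun k hk => ?_⟩
  have := congrFun (LinearMap.mem_ker.1 hc) ⟨k, hk⟩
  simpa [T, Fintype.linearCombination_apply] using this


lemma lp_hasSum_sq (x : lp (fun _ : ℕ => ℂ) 2) : HasSum (fun j => ‖x j‖ ^ 2) (‖x‖ ^ 2) := by
  have h := lp.hasSum_inner (𝕜 := ℂ) x x
  have h2 := Complex.hasSum_re h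
  convert h2 using 1
  · funext j
    exact (inner_self_eq_norm_sq (𝕜 := ℂ) (x j)).symm
  · exact (inner_self_eq_norm_sq (𝕜 := ℂ) x).symm

lemma form_bound (m : ℕ) (d : ℕ → ℝ) (a : ℕ → ℕ → ℝ) (x y : lp (fun _ : ℕ => ℂ) 2)
    (hy : ∀ j, y j = bandOp m d a x j)
    (hd : Summable fun j => d j * ‖x j‖ ^ 2)
    (hw : Summable fun j => wt m a j * ‖x j‖ ^ 2) :
    |(inner ℂ x y).re - ∑' j, d j * ‖x j‖ ^ 2| ≤ ∑' j, wt m a j * ‖x j‖ ^ 2 := by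
  obtain ⟨s, hs, hsn⟩ := off_form m a x hw
  have h := lp.hasSum_inner (𝕜 := ℂ) x y
  have hd' : HasSum (fun j => ((d j * ‖x j‖ ^ 2 : ℝ) : ℂ)) ((∑' j, d j * ‖x j‖ ^ 2 : ℝ) : ℂ) :=
    Complex.hasSum_ofReal.2 hd.hasSum
  have h2 := hd'.add hs
  have h3 : (fun j => ((d j * ‖x j‖ ^ 2 : ℝ) : ℂ) + offDiagOp m a x j * starRingEnd ℂ (x j))
      = fun j => inner ℂ (x j) (y j) := by
    funext j
    rw [RCLike.inner_apply, hy, bandOp, add_mul, mul_assoc, Complex.mul_conj']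
    push_cast; rfl
  rw [h3] at h2
  rw [h.unique h2]
  simp only [Complex.add_re, Complex.ofReal_re, add_sub_cancel_left]
  exact (Complex.abs_re_le_norm s).trans hsn

lemma dom_lemma (m : ℕ) (d : ℕ → ℝ) (a : ℕ → ℕ → ℝ) (hsa : StandingAssumptions m d a)
    (x y : lp (fun _ : ℕ => ℂ) 2) (hy : ∀ j, y j = bandOp m d a x j) :
    Summable (fun j => d j * ‖x j‖ ^ 2) ∧ Summable (fun j => wt m a j * ‖x j‖ ^ 2) := by
  obtain ⟨h1, h2⟩ := hsa
  set ε : ℝ := 1 / (4 * m + 1) with hεd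
  have hε0 : 0 < ε := by positivity
  have hε : ε * (2 * m) ≤ 1 / 2 := by
    rw [hεd, div_mul_eq_mul_div, div_le_div_iff₀ (by positivity) (by norm_num)]
    linarith
  have hev : ∀ᶠ j in atTop, 1 ≤ d j ∧ ∀ l ∈ Finset.Icc 1 m,
      ((if l ≤ j then |a l (j - l)| else 0) + |a l j|) ≤ ε * d j := by
    refine (h2.eventually_ge_atTop 1).and ?_
    rw [Filter.eventually_all_finset]
    intro l hl
    filter_upwards [h2.eventually_ge_atTop 1, (h1 l hl).eventually_le_const hε0] with j hj1 hj2
    rwa [div_le_iff₀ (by linarith)] at hj2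
  obtain ⟨N, hN⟩ := eventually_atTop.1 hev
  set N' := N + m with hN'
  set D : ℕ → ℝ := fun j => max (d j) 1 with hD
  have hD1 : ∀ j, 1 ≤ D j := fun j => le_max_right _ _
  have hDd : ∀ j, N ≤ j → D j = d j := fun j hj => max_eq_left (hN j hj).1
  have hx2 := (lp_hasSum_sq x).summable
  have hy2 := (lp_hasSum_sq y).summable
  have hxy : Summable (fun j => ‖x j‖ * ‖y j‖) := by
    refine Summable.of_nonneg_of_le (fun j => by positivity) (fun j => ?_) (hx2.add hy2)
    nlinarith [sq_nonneg (‖x j‖ - ‖y j‖), sq_nonneg (‖x j‖), sq_nonneg (‖y j‖)]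
  set h : ℕ → ℝ := fun j => ‖x j‖ * ‖y j‖ + if j < N' then D j * ‖x j‖ ^ 2 else 0 with hh
  have hhs : Summable h := by
    refine hxy.add (summable_of_ne_finset_zero (s := Finset.range N') fun j hj => ?_)
    simp at hj; simp [hj]
  have a1 : ∀ j, N ≤ j → ∀ l ∈ Finset.Icc 1 m, |a l j| ≤ ε * D j := by
    intro j hj l hl
    rw [hDd j hj]
    refine le_trans ?_ ((hN j hj).2 l hl)
    split_ifs <;> simp
  have a2 : ∀ j, N ≤ j → ∀ l ∈ Finset.Icc 1 m, l ≤ j → |a l (j - l)| ≤ ε * D j := by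
    intro j hj l hl hlj
    rw [hDd j hj]
    refine le_trans ?_ ((hN j hj).2 l hl)
    simp [hlj]
  -- truncated weights
  have main : ∀ R : ℝ, 1 ≤ R → (Summable fun j => min (D j) R * ‖x j‖ ^ 2) ∧
      ∑' j, min (D j) R * ‖x j‖ ^ 2 ≤ 2 * ∑' j, h j := by
    intro R hR
    set M : ℕ → ℝ := fun j => min (D j) R with hM
    have hM1 : ∀ j, 1 ≤ M j := fun j => le_min (hD1 j) hR
    have hs : Summable fun j => M j * ‖x j‖ ^ 2 := by
      refine Summable.of_nonneg_of_le (fun j => ?_) (fun j => ?_) (hx2.mul_left R)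
      · have := hM1 j; positivity
      · exact mul_le_mul_of_nonneg_right (min_le_right _ _) (by positivity)
    refine ⟨hs, p_bound m ε hε _ h (fun j => ?_) hs hhs fun j => ?_⟩
    · have := hM1 j; positivity
    have hsum0 : 0 ≤ ∑ l ∈ Finset.Icc 1 m, (M j * ‖x j‖ ^ 2 + (1/2 * (M (j + l) * ‖x (j + l)‖ ^ 2)
        + 1/2 * if l ≤ j then M (j - l) * ‖x (j - l)‖ ^ 2 else 0)) := by
      refine Finset.sum_nonneg fun l _ => ?_
      have e1 := hM1 j
      have e2 := hM1 (j + l)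
      have e3 := hM1 (j - l)
      split_ifs <;> positivity
    by_cases hj : j < N'
    · have : M j * ‖x j‖ ^ 2 ≤ D j * ‖x j‖ ^ 2 :=
        mul_le_mul_of_nonneg_right (min_le_left _ _) (by positivity)
      have h4 : h j = ‖x j‖ * ‖y j‖ + D j * ‖x j‖ ^ 2 := by simp [hh, hj]
      have : 0 ≤ ‖x j‖ * ‖y j‖ := by positivity
      have := mul_nonneg hε0.le hsum0
      rw [h4]; linarith
    · have h4 : h j = ‖x j‖ * ‖y j‖ := by simp [hh, hj]
      rw [h4]
      -- key weight inequality
      have kw : ∀ j k : ℕ, ∀ b : ℝ, 0 ≤ b → b ≤ ε * D j → b ≤ ε * D k →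
          M j / D j * b * (‖x j‖ * ‖x k‖) ≤
            ε * (1/2 * (M j * ‖x j‖ ^ 2) + 1/2 * (M k * ‖x k‖ ^ 2)) := by
        intro j k b hb hbj hbk
        have hDj : 0 < D j := by linarith [hD1 j]
        have e1 : M j / D j * b ≤ ε * M j := by
          rw [div_mul_eq_mul_div, div_le_iff₀ hDj]
          nlinarith [hM1 j]
        have e2 : M j / D j * b ≤ ε * M k := by
          rw [div_mul_eq_mul_div, div_le_iff₀ hDj]
          rcases le_total (D k) R with hk | hk
          · have : M k = D k := min_eq_left hk
            rw [this]
            have hMD : M j ≤ D j := min_le_left _ _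
            calc M j * b ≤ D j * (ε * D k) := by
                  refine mul_le_mul hMD hbk hb hDj.le
              _ = _ := by ring
          · have : M k = R := min_eq_right hk
            rw [this]
            have hMR : M j ≤ R := min_le_right _ _
            calc M j * b ≤ R * (ε * D j) := by
                  refine mul_le_mul hMR hbj hb (by linarith)
              _ = _ := by ring
        have hc0 : 0 ≤ M j / D j * b := by
          have := hM1 j; positivity
        set c := M j / D j * b
        have := mul_nonneg hc0 (sq_nonneg (‖x j‖ - ‖x k‖))
        have := mul_le_mul_of_nonneg_right e1 (sq_nonneg ‖x j‖)
        have := mul_le_mul_of_nonneg_right e2 (sq_nonneg ‖x k‖)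
        nlinarith
      have hDj : 0 < D j := by linarith [hD1 j]
      have hjN : N ≤ j := by omega
      have hMj := hM1 j
      have e0 : D j * ‖x j‖ ≤ ‖y j‖ + ∑ l ∈ Finset.Icc 1 m, (|a l j| * ‖x (j + l)‖ +
          if l ≤ j then |a l (j - l)| * ‖x (j - l)‖ else 0) := by
        have : (d j : ℂ) * x j = y j - offDiagOp m a x j := by rw [hy, bandOp]; ring
        have h5 : D j * ‖x j‖ = ‖y j - offDiagOp m a x j‖ := by
          rw [← this, norm_mul, Complex.norm_real, Real.norm_eq_abs, hDd j hjN,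
            abs_of_nonneg (by linarith [(hN j hjN).1])]
        rw [h5]
        refine (norm_sub_le _ _).trans (add_le_add le_rfl ?_)
        unfold offDiagOp
        refine (norm_sum_le _ _).trans (Finset.sum_le_sum fun l _ => ?_)
        refine (norm_add_le _ _).trans (add_le_add ?_ ?_)
        · simp
        · split_ifs <;> simp
      have hc : 0 ≤ M j / D j * ‖x j‖ := by positivity
      have e1 := mul_le_mul_of_nonneg_left e0 hc
      have e2 : M j / D j * ‖x j‖ * (D j * ‖x j‖) = M j * ‖x j‖ ^ 2 := by
        field_simp
      rw [e2, mul_add, Finset.mul_sum] at e1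
      refine e1.trans (add_le_add ?_ ?_)
      · have : M j / D j ≤ 1 := (div_le_one hDj).2 (min_le_left _ _)
        have := mul_le_mul_of_nonneg_right this (by positivity : 0 ≤ ‖x j‖ * ‖y j‖)
        nlinarith
      · rw [Finset.mul_sum]
        refine Finset.sum_le_sum fun l hl => ?_
        have hl' := Finset.mem_Icc.1 hl
        have k1 := kw j (j + l) (|a l j|) (abs_nonneg _) (a1 j hjN l hl)
          (by have := a2 (j + l) (by omega) l hl (by omega); simpa using this)
        have hlj : l ≤ j := by omega
        have k2 := kw j (j - l) (|a l (j - l)|) (abs_nonneg _) (a2 j hjN l hl hlj)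
          (a1 (j - l) (by omega) l hl)
        simp only [hlj, if_true]
        nlinarith
  have hDs : Summable fun j => D j * ‖x j‖ ^ 2 := by
    refine summable_of_sum_le (c := 2 * ∑' j, h j) (fun j => ?_) fun u => ?_
    · have := hD1 j
      simp only [Pi.zero_apply]; positivity
    · set R := 1 + ∑ j ∈ u, D j with hR
      have hD0 : ∀ j, 0 ≤ D j := fun j => by linarith [hD1 j]
      have hs0 : 0 ≤ ∑ j ∈ u, D j := Finset.sum_nonneg fun j _ => hD0 j
      have hR1 : 1 ≤ R := by linarith
      obtain ⟨m1, m2⟩ := main R hR1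
      refine le_trans ?_ m2
      refine le_trans (le_of_eq ?_) (m1.sum_le_tsum u fun j _ => ?_)
      · refine Finset.sum_congr rfl fun j hj => ?_
        rw [min_eq_left]
        have := Finset.single_le_sum (f := D) (fun j _ => hD0 j) hj
        linarith
      · have : 0 ≤ min (D j) R := le_min (hD0 j) (by linarith)
        positivity
  constructor
  · rw [← summable_nat_add_iff N] at hDs ⊢
    refine hDs.congr fun j => ?_
    rw [hDd _ (by omega)]
  · rw [← summable_nat_add_iff N] at hDs ⊢
    refine Summable.of_nonneg_of_le (fun j => mul_nonneg (wt_nonneg _ _ _) (by positivity))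
      (fun j => ?_) (hDs.mul_left (m * ε))
    rw [← mul_assoc]
    refine mul_le_mul_of_nonneg_right ?_ (by positivity)
    unfold wt
    refine (Finset.sum_le_card_nsmul _ _ (ε * D (j + N)) fun l hl => ?_).trans ?_
    · rw [hDd _ (by omega), add_comm]
      exact (hN (j + N) (by omega)).2 l hl
    · simp [mul_assoc]

lemma bandOp_sum (m : ℕ) (d : ℕ → ℝ) (a : ℕ → ℕ → ℝ) {ι : Type*} (s : Finset ι) (c : ι → ℂ)
    (u : ι → ℕ → ℂ) (j : ℕ) :
    bandOp m d a (fun k => ∑ i ∈ s, c i * u i k) j = ∑ i ∈ s, c i * bandOp m d a (u i) j := by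
  unfold bandOp offDiagOp
  simp only [mul_add, Finset.sum_add_distrib, Finset.mul_sum]
  congr 1
  · refine Finset.sum_congr rfl fun i _ => by ring
  · congr 1
    · rw [Finset.sum_comm]
      refine Finset.sum_congr rfl fun i _ => Finset.sum_congr rfl fun l _ => by ring
    · rw [Finset.sum_comm]
      refine Finset.sum_congr rfl fun i _ => ?_
      split_ifs with h
      · refine Finset.sum_congr rfl fun l _ => by ring
      · simp

lemma lower_bound (m : ℕ) (d : ℕ → ℝ) (a : ℕ → ℕ → ℝ) (hsa : StandingAssumptions m d a)
    (lam : ℕ → ℝ) (v : ℕ → lp (fun _ : ℕ => ℂ) 2) (heig : IsEigenSystem m d a lam v)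
    (n : ℕ) (B : ℝ) (hB : ∀ j, n ≤ j → B ≤ d j - wt m a j) : B ≤ lam n := by
  obtain ⟨ho, -, hmono, -, he⟩ := heig
  let f : ℕ → lp (fun _ : ℕ => ℂ) 2 →ₗ[ℂ] ℂ := fun k =>
    { toFun := fun x => x k
      map_add' := fun x y => by simp
      map_smul' := fun c x => by simp }
  obtain ⟨c, hc0, hc⟩ := exists_combo n v f
  set x : lp (fun _ : ℕ => ℂ) 2 := ∑ i : Fin (n+1), c i • v i with hx
  set y : lp (fun _ : ℕ => ℂ) 2 := ∑ i : Fin (n+1), (c i * lam i) • v i with hyd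
  have hx0 : ∀ k, k < n → x k = 0 := fun k hk => hc k hk
  have hxc : (x : ℕ → ℂ) = fun k => ∑ i : Fin (n+1), c i * v i k := by
    funext k
    rw [hx, lp.coeFn_sum]; simp
  have hy : ∀ j, y j = bandOp m d a x j := by
    intro j
    rw [hxc, bandOp_sum, hyd, lp.coeFn_sum]
    simp [he, mul_assoc]
  have ho' : Orthonormal ℂ (fun i : Fin (n+1) => v i) := ho.comp _ Fin.val_injective
  have hxx : ‖x‖ ^ 2 = ∑ i, ‖c i‖ ^ 2 := by
    have h1 : inner ℂ x x = ∑ i, starRingEnd ℂ (c i) * c i := ho'.inner_sum c c Finset.univ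
    have h2 : (‖x‖ ^ 2 : ℝ) = (inner ℂ x x).re := (inner_self_eq_norm_sq (𝕜 := ℂ) x).symm
    rw [h2, h1, Complex.re_sum]
    refine Finset.sum_congr rfl fun i _ => ?_
    rw [Complex.conj_mul', ← Complex.ofReal_pow, Complex.ofReal_re]
  have hxy : (inner ℂ x y).re = ∑ i : Fin (n+1), lam i * ‖c i‖ ^ 2 := by
    have h1 : inner ℂ x y = ∑ i, starRingEnd ℂ (c i) * (c i * lam i) :=
      ho'.inner_sum c (fun i => c i * lam i) Finset.univ
    rw [h1, Complex.re_sum]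
    refine Finset.sum_congr rfl fun i _ => ?_
    rw [← mul_assoc, Complex.conj_mul', ← Complex.ofReal_pow, ← Complex.ofReal_mul,
      Complex.ofReal_re, mul_comm]
  have hpos : 0 < ‖x‖ ^ 2 := by
    rw [hxx]
    obtain ⟨i, hi⟩ := Function.ne_iff.1 hc0
    refine Finset.sum_pos' (fun i _ => by positivity) ⟨i, Finset.mem_univ _, ?_⟩
    have : 0 < ‖c i‖ := norm_pos_iff.2 hi
    positivity
  have hup : (inner ℂ x y).re ≤ lam n * ‖x‖ ^ 2 := by
    rw [hxy, hxx, Finset.mul_sum]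
    refine Finset.sum_le_sum fun i _ => mul_le_mul_of_nonneg_right (hmono (by omega)) (by positivity)
  obtain ⟨s1, s2⟩ := dom_lemma m d a hsa x y hy
  have hf := (abs_le.1 (form_bound m d a x y hy s1 s2)).1
  have hlow : B * ‖x‖ ^ 2 ≤ (∑' j, d j * ‖x j‖ ^ 2) - ∑' j, wt m a j * ‖x j‖ ^ 2 := by
    refine hasSum_le (fun j => ?_) ((lp_hasSum_sq x).mul_left B) (s1.hasSum.sub s2.hasSum)
    rcases lt_or_ge j n with hj | hj
    · simp [hx0 j hj]
    · rw [← sub_mul]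
      exact mul_le_mul_of_nonneg_right (hB j hj) (by positivity)
  refine le_of_mul_le_mul_right ?_ hpos
  linarith

lemma upper_bound (m : ℕ) (d : ℕ → ℝ) (a : ℕ → ℕ → ℝ)
    (lam : ℕ → ℝ) (v : ℕ → lp (fun _ : ℕ => ℂ) 2) (heig : IsEigenSystem m d a lam v)
    (n : ℕ) (B : ℝ) (hB : ∀ j, j ≤ n → d j + wt m a j ≤ B) : lam n ≤ B := by
  obtain ⟨ho, hsp, hmono, -, he⟩ := heig
  let f : ℕ → lp (fun _ : ℕ => ℂ) 2 →ₗ[ℂ] ℂ := fun k => (innerSL ℂ (v k)).toLinearMap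
  obtain ⟨c, hc0, hc⟩ := exists_combo n (fun i => (lp.single 2 i (1:ℂ) : lp (fun _ : ℕ => ℂ) 2)) f
  set x : lp (fun _ : ℕ => ℂ) 2 := ∑ i : Fin (n+1), c i • lp.single 2 (i:ℕ) (1:ℂ) with hx
  have hxv : ∀ k, k < n → inner ℂ (v k) x = 0 := fun k hk => hc k hk
  have hxj : ∀ j, x j = ∑ i : Fin (n+1), c i * (Pi.single (i:ℕ) (1:ℂ) : ℕ → ℂ) j := by
    intro j
    rw [hx, lp.coeFn_sum]; simp [lp.single_apply]
  have hx0 : ∀ j, n < j → x j = 0 := by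
    intro j hj
    rw [hxj]
    refine Finset.sum_eq_zero fun i _ => ?_
    rw [Pi.single_eq_of_ne (by omega), mul_zero]
  have hxi : ∀ i : Fin (n+1), x i = c i := by
    intro i
    rw [hxj, Finset.sum_eq_single i]
    · simp
    · intro k _ hk
      rw [Pi.single_eq_of_ne (fun h => hk (Fin.ext h.symm)), mul_zero]
    · simp
  have hpos : 0 < ‖x‖ ^ 2 := by
    have : x ≠ 0 := by
      intro h
      apply hc0
      funext i
      rw [← hxi i, h]; simp
    have := norm_pos_iff.2 this
    positivity
  have hAx0 : ∀ j, j ∉ Finset.range (n + m + 1) → bandOp m d a x j = 0 := by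
    intro j hj
    simp at hj
    unfold bandOp offDiagOp
    rw [hx0 j (by omega), mul_zero, zero_add]
    refine Finset.sum_eq_zero fun l hl => ?_
    have := Finset.mem_Icc.1 hl
    rw [hx0 (j + l) (by omega), hx0 (j - l) (by omega)]
    simp
  have hmem : Memℓp (bandOp m d a x) 2 := by
    refine memℓp_gen (summable_of_ne_finset_zero (s := Finset.range (n + m + 1)) fun j hj => ?_)
    rw [hAx0 j hj]; simp
  set y : lp (fun _ : ℕ => ℂ) 2 := ⟨bandOp m d a x, hmem⟩ with hyd
  have hy : ∀ j, y j = bandOp m d a x j := fun j => rfl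
  have hvy : ∀ k, inner ℂ (v k) y = lam k * inner ℂ (v k) x := by
    intro k
    obtain ⟨s, hs1, hs2⟩ := symm_form m d a (v k) x n hx0
    have h1 := lp.hasSum_inner (𝕜 := ℂ) (v k) y
    have h2 := (lp.hasSum_inner (𝕜 := ℂ) (v k) x).mul_left (lam k : ℂ)
    simp only [RCLike.inner_apply] at h1 h2
    rw [h1.unique hs1]
    refine hs2.unique ?_
    have e : (fun j => x j * starRingEnd ℂ (bandOp m d a (v k) j)) =
        fun j => (lam k : ℂ) * (x j * starRingEnd ℂ (v k j)) := by
      funext j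
      rw [he, map_mul, Complex.conj_ofReal]; ring
    rw [e]
    exact h2
  let b := HilbertBasis.mk ho hsp.ge
  have hb : ∀ k, b k = v k := fun k => by simp [b]
  have P1 := Complex.hasSum_re (b.hasSum_inner_mul_inner x y)
  have P2 := Complex.hasSum_re (b.hasSum_inner_mul_inner x x)
  have t1 : ∀ k, (inner ℂ x (v k) * inner ℂ (v k) x : ℂ) = ((‖(inner ℂ (v k) x : ℂ)‖ ^ 2 : ℝ) : ℂ) := by
    intro k
    rw [← inner_conj_symm, Complex.conj_mul']
    push_cast; rfl
  have hlow : lam n * ‖x‖ ^ 2 ≤ (inner ℂ x y).re := by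
    have e : (‖x‖ ^ 2 : ℝ) = (inner ℂ x x).re := (inner_self_eq_norm_sq (𝕜 := ℂ) x).symm
    rw [e]
    refine hasSum_le (fun k => ?_) (P2.mul_left (lam n)) P1
    rw [hb, hvy, mul_left_comm, t1, ← Complex.ofReal_mul, Complex.ofReal_re, Complex.ofReal_re]
    rcases lt_or_ge k n with hk | hk
    · rw [hxv k hk]; simp
    · exact mul_le_mul_of_nonneg_right (hmono hk) (by positivity)
  have s1 : Summable fun j => d j * ‖x j‖ ^ 2 := by
    refine summable_of_ne_finset_zero (s := Finset.range (n+1)) fun j hj => ?_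
    rw [hx0 j (by simp at hj; omega)]; simp
  have s2 : Summable fun j => wt m a j * ‖x j‖ ^ 2 := by
    refine summable_of_ne_finset_zero (s := Finset.range (n+1)) fun j hj => ?_
    rw [hx0 j (by simp at hj; omega)]; simp
  have hf := (abs_le.1 (form_bound m d a x y hy s1 s2)).2
  have hup : (∑' j, d j * ‖x j‖ ^ 2) + ∑' j, wt m a j * ‖x j‖ ^ 2 ≤ B * ‖x‖ ^ 2 := by
    refine hasSum_le (fun j => ?_) (s1.hasSum.add s2.hasSum) ((lp_hasSum_sq x).mul_left B)
    rcases lt_or_ge n j with hj | hj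
    · simp [hx0 j hj]
    · rw [← add_mul]
      exact mul_le_mul_of_nonneg_right (hB j hj) (by positivity)
  refine le_of_mul_le_mul_right ?_ hpos
  linarith

lemma rpow_diff (δ : ℝ) : (fun j : ℕ => ((j + 1 : ℕ) : ℝ) ^ δ - (j : ℝ) ^ δ)
    =O[atTop] fun j : ℕ => (j : ℝ) ^ (δ - 1) := by
  have h1 : HasDerivAt (fun t : ℝ => (1 + t) ^ δ) (δ * (1 + 0) ^ (δ - 1)) 0 := by
    have := (Real.hasDerivAt_rpow_const (x := 1 + 0) (p := δ) (Or.inl (by norm_num)))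
    simpa using this.comp_const_add 1 0
  have h2 := h1.isBigO_sub.comp_tendsto (tendsto_inv_atTop_nhds_zero_nat (𝕜 := ℝ))
  have h3 := (Asymptotics.isBigO_refl (fun j : ℕ => (j : ℝ) ^ δ) atTop).mul h2
  refine h3.congr' ?_ ?_
  · filter_upwards [eventually_gt_atTop 0] with j hj
    have hj' : (0 : ℝ) < j := by exact_mod_cast hj
    simp only [Function.comp, add_zero, Real.one_rpow, mul_sub, mul_one]
    rw [← Real.mul_rpow hj'.le (by positivity)]
    congr 2
    push_cast
    field_simp
  · filter_upwards [eventually_gt_atTop 0] with j hj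
    have hj' : (0 : ℝ) < j := by exact_mod_cast hj
    simp only [Function.comp, sub_zero]
    rw [Real.rpow_sub_one hj'.ne']
    rfl

lemma rpow_shift (δ : ℝ) (l : ℕ) : (fun j : ℕ => ((j - l : ℕ) : ℝ) ^ δ)
    =O[atTop] fun j : ℕ => (j : ℝ) ^ δ := by
  have h0 : Tendsto (fun j : ℕ => 1 - (l : ℝ) * (j : ℝ)⁻¹) atTop (nhds 1) := by
    simpa using ((tendsto_inv_atTop_nhds_zero_nat (𝕜 := ℝ)).const_mul (l : ℝ)).const_sub 1
  have h1 : Tendsto (fun j : ℕ => (1 - (l : ℝ) * (j : ℝ)⁻¹) ^ δ) atTop (nhds (1 ^ δ)) :=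
    h0.rpow_const (Or.inl one_ne_zero)
  have h3 := (Asymptotics.isBigO_refl (fun j : ℕ => (j : ℝ) ^ δ) atTop).mul (h1.isBigO_one ℝ)
  refine h3.congr' ?_ ?_
  · filter_upwards [eventually_gt_atTop l] with j hj
    have hj' : (0 : ℝ) < j := by exact_mod_cast (by omega : 0 < j)
    have hlj : (l : ℝ) < j := by exact_mod_cast hj
    have e : (1 - (l : ℝ) * (j : ℝ)⁻¹) = (j - l) / j := by field_simp
    rw [e, ← Real.mul_rpow hj'.le (div_nonneg (by linarith) hj'.le)]
    congr 1
    rw [Nat.cast_sub hj.le]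
    field_simp
  · simp

lemma wt_bigO (m : ℕ) (a : ℕ → ℕ → ℝ) (δ : ℝ) (ha : ∀ l ∈ Finset.Icc 1 m,
      (fun n : ℕ => a l n) =O[atTop] fun n : ℕ => (n : ℝ) ^ δ) :
    (fun j => wt m a j) =O[atTop] fun n : ℕ => (n : ℝ) ^ δ := by
  unfold wt
  refine Asymptotics.IsBigO.fun_sum fun l hl => ((ha l hl).abs_left).add ?_
  have h := ((ha l hl).comp_tendsto (tendsto_sub_atTop_nat l)).trans (rpow_shift δ l)
  refine h.abs_left.congr' ?_ EventuallyEq.rfl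
  filter_upwards [eventually_ge_atTop l] with j hj
  simp [hj]

end BandAux

/-- Theorem 3.1. If `d(n+1) − d(n) ≥ C⁻¹ n^{δ+κ−1}` for
`n > n₀` (with `C > 0`, `κ > 0`, `δ + κ > 0`) and `a_l(n) = O(n^δ)` for each
`l = 1,…,m`, then `λ_n(A) = d(n) + O(n^δ)` as `n → ∞`. -/
theorem eigenvalue_asymptotics_minmax
    (m : ℕ) (d : ℕ → ℝ) (a : ℕ → ℕ → ℝ)
    (hsa : StandingAssumptions m d a)
    (lam : ℕ → ℝ) (v : ℕ → lp (fun _ : ℕ => ℂ) 2)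
    (heig : IsEigenSystem m d a lam v)
    (C δ κ : ℝ) (hC : 0 < C) (hκ : 0 < κ) (hδκ : 0 < δ + κ) (n₀ : ℕ)
    (hd : ∀ n : ℕ, n₀ < n → C⁻¹ * (n : ℝ) ^ (δ + κ - 1) ≤ d (n + 1) - d n)
    (ha : ∀ l ∈ Finset.Icc 1 m,
      (fun n : ℕ => a l n) =O[atTop] fun n : ℕ => (n : ℝ) ^ δ) :
    (fun n : ℕ => lam n - d n) =O[atTop] fun n : ℕ => (n : ℝ) ^ δ := by
  classical
  obtain ⟨K, hK0, hK⟩ := (BandAux.wt_bigO m a δ ha).exists_pos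
  have hlo : (fun j : ℕ => (j : ℝ) ^ (δ - 1)) =o[atTop] fun j : ℕ => (j : ℝ) ^ (δ + κ - 1) := by
    refine (Asymptotics.isLittleO_of_tendsto' ?_ ?_)
    · filter_upwards [eventually_gt_atTop 0] with j hj h0
      have hj' : (0 : ℝ) < j := by exact_mod_cast hj
      exact absurd h0 (Real.rpow_pos_of_pos hj' _).ne'
    · refine ((tendsto_rpow_neg_atTop hκ).comp tendsto_natCast_atTop_atTop).congr' ?_
      filter_upwards [eventually_gt_atTop 0] with j hj
      have hj' : (0 : ℝ) < j := by exact_mod_cast hj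
      simp only [Function.comp]
      rw [← Real.rpow_sub hj']
      congr 1
      ring
  have hdiff := (BandAux.rpow_diff δ).trans_isLittleO hlo
  have hev1 := hdiff.bound (show 0 < C⁻¹ / K by positivity)
  obtain ⟨N, hN⟩ := eventually_atTop.1 ((hev1.and hK.bound).and (eventually_gt_atTop n₀))
  have hstep : ∀ j, N ≤ j → K * |((j + 1 : ℕ) : ℝ) ^ δ - (j : ℝ) ^ δ| ≤ d (j + 1) - d j := by
    intro j hj
    have h1 := (hN j hj).1.1
    refine le_trans ?_ (hd j (hN j hj).2)
    rw [Real.norm_eq_abs, Real.norm_eq_abs, abs_of_nonneg (a := (j : ℝ) ^ (δ + κ - 1))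
      (by positivity), div_mul_eq_mul_div, le_div_iff₀ hK0] at h1
    linarith
  have hwt : ∀ j, N ≤ j → BandAux.wt m a j ≤ K * (j : ℝ) ^ δ := by
    intro j hj
    have h1 := (hN j hj).1.2
    rw [Real.norm_eq_abs, Real.norm_eq_abs, abs_of_nonneg (a := (j : ℝ) ^ δ)
      (by positivity)] at h1
    exact (le_abs_self _).trans h1
  have mp : ∀ i j, N ≤ i → i ≤ j → d i + K * (i : ℝ) ^ δ ≤ d j + K * (j : ℝ) ^ δ := by
    intro i j hi hij
    induction j, hij using Nat.le_induction with
    | base => exact le_rfl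
    | succ k hk ih =>
      have h1 := hstep k (hi.trans hk)
      have h2 := mul_le_mul_of_nonneg_left (neg_abs_le (((k + 1 : ℕ) : ℝ) ^ δ - (k : ℝ) ^ δ)) hK0.le
      linarith
  have mm : ∀ i j, N ≤ i → i ≤ j → d i - K * (i : ℝ) ^ δ ≤ d j - K * (j : ℝ) ^ δ := by
    intro i j hi hij
    induction j, hij using Nat.le_induction with
    | base => exact le_rfl
    | succ k hk ih =>
      have h1 := hstep k (hi.trans hk)
      have h2 := mul_le_mul_of_nonneg_left (le_abs_self (((k + 1 : ℕ) : ℝ) ^ δ - (k : ℝ) ^ δ)) hK0.le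
      linarith
  have hsmall : ∀ᶠ n in atTop, ∀ j ∈ Finset.range N, d j + BandAux.wt m a j ≤ d n := by
    rw [Filter.eventually_all_finset]
    intro j _
    exact hsa.2.eventually_ge_atTop _
  refine Asymptotics.IsBigO.of_bound K ?_
  filter_upwards [hsmall, eventually_ge_atTop N] with n hn hnN
  have hp : 0 ≤ (n : ℝ) ^ δ := by positivity
  rw [Real.norm_eq_abs, Real.norm_eq_abs, abs_of_nonneg hp, abs_le]
  have hl := BandAux.lower_bound m d a hsa lam v heig n (d n - K * (n : ℝ) ^ δ) (by
    intro j hj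
    have := mm n j hnN hj
    have := hwt j (hnN.trans hj)
    linarith)
  have hu := BandAux.upper_bound m d a lam v heig n (d n + K * (n : ℝ) ^ δ) (by
    intro j hj
    rcases lt_or_ge j N with h | h
    · have := hn j (Finset.mem_range.2 h)
      have := mul_nonneg hK0.le hp
      linarith
    · have := mp j n h hj
      have := hwt j h
      linarith)
  constructor <;> linarith
end

section
/- Let P_n = Σ_{1≤l≤m}(S^l p_{n,l}(Λ) + p_{n,l}(Λ)S^{l*}) and A_n = Σ_{1≤l≤m}(S^l a_{n,l}(Λ) + a_{n,l}(Λ)S^{l*}) be symmetric band operators on l²(ℕ*) with real bands supported in {j : |j−n| ≤ 2τ_n} (for p_{n,l}) and of bandwidth at most m. For s ≥ 0 set α_{n,s}(j) = max_{|l|≤m, |i|≤s}|a_{n,l}(j+i)|, β_{n,s}(j) = max_{|l|≤m,|i|≤s}|p_{n,l}(j+i)|, α'_{n,s}(j) = max_{|l|≤m,|i|≤s}|Δa_{n,l}(j+i)|, β'_{n,s}(j) = max_{|l|≤m,|i|≤s}|Δp_{n,l}(j+i)|, and ρ_{n,s}(j) = α_{n,s}(j)β'_{n,s}(j) + α'_{n,s}(j)β_{n,s}(j).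 Then ‖[P_n, A_n]‖ ≤ 10 m³ sup_{|i| ≤ 2τ_n + 4m} ρ_{n,4m}(n+i). -/
open scoped ENNReal NNReal

/- Here `l²(ℕ*)` is embedded in the space of sequences indexed by `ℤ`: all
band functions vanish at nonpositive indices, so the band operators act on
sequences `x : ℤ → ℂ` and preserve (and vanish off) the subspace supported
in the positive integers; their `l²(ℕ*)` operator norms coincide with the
bounds below. -/

/-- the symmetric band operator `Σ_{1≤l≤m}(S^l c_l(Λ) + c_l(Λ) S^{*l})`. -/
noncomputable def bandAct (m : ℕ) (c : ℕ → ℤ → ℝ) (x : ℤ → ℂ) (i : ℤ) : ℂ :=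
  ∑ l ∈ Finset.Icc 1 m, ((c l (i - l) : ℂ) * x (i - l) + (c l i : ℂ) * x (i + l))

/-- `max_{1≤l≤m, |i|≤s} |c_l(j+i)|` (by the symmetry convention
`c_{-l} = c_l`, `c_0 = 0`, this is the paper's maximum over `|l| ≤ m`). -/
noncomputable def bandSup (m s : ℕ) (hm : 1 ≤ m) (c : ℕ → ℤ → ℝ) (j : ℤ) : ℝ :=
  Finset.sup' (Finset.Icc 1 m ×ˢ Finset.Icc (-(s : ℤ)) (s : ℤ))
    ⟨(1, 0), by simp [hm]⟩ (fun q => |c q.1 (j + q.2)|)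

/-- first difference in the (second) index. -/
noncomputable def Δband (c : ℕ → ℤ → ℝ) : ℕ → ℤ → ℝ := fun l j => c l (j + 1) - c l j

/-- `ρ_{n,s}(j) = α_{n,s}(j)β'_{n,s}(j) + α'_{n,s}(j)β_{n,s}(j)`. -/
noncomputable def rhoNS (m s : ℕ) (hm : 1 ≤ m) (a p : ℕ → ℤ → ℝ) (j : ℤ) : ℝ :=
  bandSup m s hm a j * bandSup m s hm (Δband p) j
    + bandSup m s hm (Δband a) j * bandSup m s hm p j


noncomputable def shK (q : ℕ × Bool) : ℤ := if q.2 then (q.1 : ℤ) else -(q.1 : ℤ)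

noncomputable def coK (c : ℕ → ℤ → ℝ) (q : ℕ × Bool) (i : ℤ) : ℝ :=
  if q.2 then c q.1 i else c q.1 (i - q.1)

def setK (m : ℕ) : Finset (ℕ × Bool) := Finset.Icc 1 m ×ˢ Finset.univ

lemma card_setK (m : ℕ) : (setK m).card = 2 * m := by
  simp [setK, mul_comm]

lemma bandAct_eq (m : ℕ) (c : ℕ → ℤ → ℝ) (x : ℤ → ℂ) (i : ℤ) :
    bandAct m c x i = ∑ q ∈ setK m, (coK c q i : ℂ) * x (i + shK q) := by
  simp only [bandAct, setK, Finset.sum_product, coK, shK]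
  refine Finset.sum_congr rfl fun l _ => ?_
  simp [add_comm, sub_eq_add_neg]

lemma le_bandSup (m s : ℕ) (hm : 1 ≤ m) (c : ℕ → ℤ → ℝ) (j t : ℤ) (l : ℕ)
    (hl : l ∈ Finset.Icc 1 m) (h : |t - j| ≤ s) : |c l t| ≤ bandSup m s hm c j := by
  have := Finset.le_sup' (s := Finset.Icc 1 m ×ˢ Finset.Icc (-(s : ℤ)) (s : ℤ))
    (fun q : ℕ × ℤ => |c q.1 (j + q.2)|) (b := (l, t - j)) (by
      rw [abs_le] at h
      simp only [Finset.mem_product, Finset.mem_Icc] at hl ⊢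
      exact ⟨hl, h⟩)
  simpa [bandSup] using this

lemma bandSup_nonneg (m s : ℕ) (hm : 1 ≤ m) (c : ℕ → ℤ → ℝ) (j : ℤ) :
    0 ≤ bandSup m s hm c j :=
  (abs_nonneg _).trans (le_bandSup m s hm c j j 1 (by simp [hm]) (by simp))

lemma diff_nat (f : ℤ → ℝ) (B : ℝ) (j : ℤ) (k : ℕ)
    (h : ∀ t : ℤ, j ≤ t → t < j + k → |f (t + 1) - f t| ≤ B) :
    |f (j + k) - f j| ≤ k * B := by
  induction k with
  | zero => simp
  | succ k ih =>
    have h1 := ih fun t h1 h2 => h t h1 (by push_cast; omega)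
    have h2 := h (j + k) (by omega) (by push_cast; omega)
    have h3 := abs_sub_le (f (j + k + 1)) (f (j + k)) (f j)
    push_cast
    rw [← add_assoc]
    linarith

lemma diff_band (m : ℕ) (hm : 1 ≤ m) (c : ℕ → ℤ → ℝ) (i u v : ℤ) (l : ℕ)
    (hl : l ∈ Finset.Icc 1 m) (hu : |u - i| ≤ 2 * m) (hv : |v - i| ≤ 2 * m) (huv : |u - v| ≤ m) :
    |c l u - c l v| ≤ m * bandSup m (4 * m) hm (Δband c) i := by
  have hB := bandSup_nonneg m (4 * m) hm (Δband c) i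
  wlog h : v ≤ u generalizing u v
  · rw [abs_sub_comm]
    exact this v u hv hu (by rwa [abs_sub_comm]) (by omega)
  obtain ⟨k, rfl⟩ := Int.le.dest h
  rw [abs_le] at hu hv huv
  have := diff_nat (c l) (bandSup m (4 * m) hm (Δband c) i) v k (fun t h1 h2 =>
    le_bandSup m (4 * m) hm (Δband c) i t l hl (by rw [abs_le]; push_cast; omega))
  refine this.trans (mul_le_mul_of_nonneg_right ?_ hB)
  have : k ≤ m := by omega
  exact_mod_cast this

lemma shK_abs (m : ℕ) (q : ℕ × Bool) (hq : q ∈ setK m) : |shK q| ≤ m := by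
  obtain ⟨l, b⟩ := q
  simp [setK] at hq
  cases b <;> simp [shK] <;> omega

lemma coK_le (m : ℕ) (hm : 1 ≤ m) (c : ℕ → ℤ → ℝ) (i : ℤ) (q : ℕ × Bool) (hq : q ∈ setK m) :
    |coK c q i| ≤ bandSup m (4 * m) hm c i := by
  obtain ⟨l, b⟩ := q
  simp [setK] at hq
  cases b <;> simp only [coK, if_true, if_false, Bool.false_eq_true] <;>
    refine le_bandSup m (4 * m) hm c i _ l (by simpa using hq) ?_ <;>
    rw [abs_le] <;> push_cast <;> omega

lemma coK_diff (m : ℕ) (hm : 1 ≤ m) (c : ℕ → ℤ → ℝ) (i k : ℤ) (hk : |k| ≤ m)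
    (q : ℕ × Bool) (hq : q ∈ setK m) :
    |coK c q (i + k) - coK c q i| ≤ m * bandSup m (4 * m) hm (Δband c) i := by
  obtain ⟨l, b⟩ := q
  simp [setK] at hq
  rw [abs_le] at hk
  cases b <;> simp only [coK, if_true, if_false, Bool.false_eq_true] <;>
    refine diff_band m hm c i _ _ l (by simpa using hq) ?_ ?_ ?_ <;>
    rw [abs_le] <;> omega

lemma coK_zero (m : ℕ) (n τ : ℕ) (p : ℕ → ℤ → ℝ)
    (hpsupp : ∀ l : ℕ, ∀ j : ℤ, 2 * (τ : ℤ) ≤ |j - (n : ℤ)| → p l j = 0)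
    (i : ℤ) (hi : 2 * (τ : ℤ) + m ≤ |i - n|) (q : ℕ × Bool) (hq : q ∈ setK m) :
    coK p q i = 0 := by
  obtain ⟨l, b⟩ := q
  simp [setK] at hq
  rw [le_abs] at hi
  cases b <;> simp only [coK, if_true, if_false, Bool.false_eq_true] <;> apply hpsupp <;>
    rw [le_abs] <;> omega

lemma comm_eq (m : ℕ) (a p : ℕ → ℤ → ℝ) (x : ℤ → ℂ) (i : ℤ) :
    bandAct m p (bandAct m a x) i - bandAct m a (bandAct m p x) i
      = ∑ r ∈ setK m ×ˢ setK m,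
        ((coK p r.1 i * coK a r.2 (i + shK r.1) - coK a r.2 i * coK p r.1 (i + shK r.2) : ℝ) : ℂ)
          * x (i + (shK r.1 + shK r.2)) := by
  simp only [bandAct_eq, Finset.mul_sum]
  rw [Finset.sum_comm (s := setK m) (t := setK m)
    (f := fun q r => (coK a q i : ℂ) * (coK p r (i + shK q) * x (i + shK q + shK r))),
    Finset.sum_product, ← Finset.sum_sub_distrib]
  refine Finset.sum_congr rfl fun q _ => ?_
  rw [← Finset.sum_sub_distrib]
  refine Finset.sum_congr rfl fun r _ => ?_
  rw [show i + shK r + shK q = i + (shK q + shK r) by ring, ← add_assoc i]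
  push_cast
  ring

lemma coef_le (m : ℕ) (hm : 1 ≤ m) (n τ : ℕ) (a p : ℕ → ℤ → ℝ)
    (hpsupp : ∀ l : ℕ, ∀ j : ℤ, 2 * (τ : ℤ) ≤ |j - (n : ℤ)| → p l j = 0)
    (M : ℝ) (hM0 : 0 ≤ M)
    (hM : ∀ i : ℤ, |i - n| ≤ 2 * (τ : ℤ) + 4 * m → rhoNS m (4 * m) hm a p i ≤ M)
    (i : ℤ) (q r : ℕ × Bool) (hq : q ∈ setK m) (hr : r ∈ setK m) :
    |coK p q i * coK a r (i + shK q) - coK a r i * coK p q (i + shK r)| ≤ m * M := by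
  have hs := shK_abs m r hr
  by_cases hi : |i - n| ≤ 2 * (τ : ℤ) + 4 * m
  · have h1 := coK_le m hm p i q hq
    have h2 := coK_le m hm a i r hr
    have h3 := coK_diff m hm a i (shK q) (shK_abs m q hq) r hr
    have h4 := coK_diff m hm p i (shK r) hs q hq
    have h5 := hM i hi
    have e : coK p q i * coK a r (i + shK q) - coK a r i * coK p q (i + shK r)
      = coK p q i * (coK a r (i + shK q) - coK a r i)
        - coK a r i * (coK p q (i + shK r) - coK p q i) := by ring
    rw [e]
    refine (abs_sub _ _).trans ?_
    rw [abs_mul, abs_mul]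
    have h6 := mul_le_mul h1 h3 (abs_nonneg _) (bandSup_nonneg _ _ _ _ _)
    have h7 := mul_le_mul h2 h4 (abs_nonneg _) (bandSup_nonneg _ _ _ _ _)
    have h8 := mul_le_mul_of_nonneg_left h5 (Nat.cast_nonneg (α := ℝ) m)
    rw [rhoNS] at h8
    linarith
  · rw [coK_zero m n τ p hpsupp i (by omega) q hq,
      coK_zero m n τ p hpsupp (i + shK r) (by
        rw [abs_le] at hi hs
        rw [le_abs]
        omega) q hq]
    simp only [zero_mul, mul_zero, sub_zero, abs_zero]
    positivity

lemma tsum_bound (N : ℕ) (C : ℝ) (hC : 0 ≤ C) {ι : Type*} (s : Finset ι) (hs : s.card = N)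
    (σ : ι → ℤ) (D : ι → ℤ → ℝ) (hD : ∀ r ∈ s, ∀ i, |D r i| ≤ C) (x : ℤ → ℂ) :
    (∑' i : ℤ, (‖∑ r ∈ s, (D r i : ℂ) * x (i + σ r)‖₊ : ℝ≥0∞) ^ 2)
      ≤ ENNReal.ofReal ((N * C) ^ 2) * ∑' i : ℤ, (‖x i‖₊ : ℝ≥0∞) ^ 2 := by
  lift C to ℝ≥0 using hC
  have key : ∀ i, (‖∑ r ∈ s, (D r i : ℂ) * x (i + σ r)‖₊ : ℝ≥0∞) ^ 2
      ≤ ((C ^ 2 * N : ℝ≥0) : ℝ≥0∞) * ∑ r ∈ s, (‖x (i + σ r)‖₊ : ℝ≥0∞) ^ 2 := by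
    intro i
    have : ‖∑ r ∈ s, (D r i : ℂ) * x (i + σ r)‖₊ ^ 2
        ≤ C ^ 2 * N * ∑ r ∈ s, ‖x (i + σ r)‖₊ ^ 2 := by
      rw [← NNReal.coe_le_coe]
      push_cast
      have h1 : ‖∑ r ∈ s, (D r i : ℂ) * x (i + σ r)‖ ≤ C * ∑ r ∈ s, ‖x (i + σ r)‖ := by
        refine (norm_sum_le _ _).trans ?_
        rw [Finset.mul_sum]
        refine Finset.sum_le_sum fun r hr => ?_
        rw [norm_mul, Complex.norm_real]
        exact mul_le_mul_of_nonneg_right (hD r hr i) (norm_nonneg _)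
      have h2 := pow_le_pow_left₀ (norm_nonneg _) h1 2
      have h3 := sq_sum_le_card_mul_sum_sq (s := s) (f := fun r => ‖x (i + σ r)‖)
      rw [hs] at h3
      rw [mul_pow] at h2
      rw [mul_assoc]
      exact h2.trans (mul_le_mul_of_nonneg_left h3 (by positivity))
    exact_mod_cast this
  refine (ENNReal.tsum_le_tsum key).trans ?_
  rw [ENNReal.tsum_mul_left, Summable.tsum_finsetSum (fun _ _ => ENNReal.summable)]
  have : ∀ r ∈ s, ∑' i : ℤ, (‖x (i + σ r)‖₊ : ℝ≥0∞) ^ 2 = ∑' i : ℤ, (‖x i‖₊ : ℝ≥0∞) ^ 2 :=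
    fun r _ => (Equiv.addRight (σ r)).tsum_eq (fun i => (‖x i‖₊ : ℝ≥0∞) ^ 2)
  rw [Finset.sum_congr rfl this, Finset.sum_const, hs, nsmul_eq_mul, ← mul_assoc]
  refine le_of_eq ?_
  congr 1
  have : ((N : ℝ) * C) ^ 2 = ((C ^ 2 * N * N : ℝ≥0) : ℝ) := by push_cast; ring
  rw [this, ENNReal.ofReal_coe_nnreal]
  push_cast
  rfl

/-- Lemma 6.1. Let `P_n`, `A_n` be symmetric band operators
with real bands `p_{n,l}`, `a_{n,l}` (`1 ≤ l ≤ m`) vanishing at nonpositive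
indices, the bands of `P_n` being supported in `{j : |j−n| < 2τ_n}`.  Then
`‖[P_n, A_n]‖ ≤ 10 m³ sup_{|i| ≤ 2τ_n + 4m} ρ_{n,4m}(n+i)` (the operator-norm
bound is expressed through the quadratic forms, with sums in `ℝ≥0∞`). -/
theorem commutator_norm_estimate
    (m : ℕ) (hm : 1 ≤ m) (n τ : ℕ) (a p : ℕ → ℤ → ℝ)
    (ha0 : ∀ l : ℕ, ∀ j : ℤ, j ≤ 0 → a l j = 0)
    (hp0 : ∀ l : ℕ, ∀ j : ℤ, j ≤ 0 → p l j = 0)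
    (hpsupp : ∀ l : ℕ, ∀ j : ℤ, 2 * (τ : ℤ) ≤ |j - (n : ℤ)| → p l j = 0) :
    ∀ x : ℤ → ℂ,
      (∑' i : ℤ, (‖bandAct m p (bandAct m a x) i - bandAct m a (bandAct m p x) i‖₊ : ℝ≥0∞) ^ 2)
        ≤ ENNReal.ofReal ((10 * (m : ℝ) ^ 3 *
            Finset.sup' (Finset.Icc (-(2 * (τ : ℤ) + 4 * m)) (2 * (τ : ℤ) + 4 * m))
              ⟨0, by simp [Finset.mem_Icc]; omega⟩
              (fun i => rhoNS m (4 * m) hm a p ((n : ℤ) + i))) ^ 2)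
          * ∑' i : ℤ, (‖x i‖₊ : ℝ≥0∞) ^ 2 := by
  intro x
  set M := Finset.sup' (Finset.Icc (-(2 * (τ : ℤ) + 4 * m)) (2 * (τ : ℤ) + 4 * m))
              ⟨0, by simp [Finset.mem_Icc]; omega⟩
              (fun i => rhoNS m (4 * m) hm a p ((n : ℤ) + i)) with hMdef
  have hM : ∀ i : ℤ, |i - n| ≤ 2 * (τ : ℤ) + 4 * m → rhoNS m (4 * m) hm a p i ≤ M := by
    intro i hi
    have := Finset.le_sup' (s := Finset.Icc (-(2 * (τ : ℤ) + 4 * m)) (2 * (τ : ℤ) + 4 * m))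
      (fun i => rhoNS m (4 * m) hm a p ((n : ℤ) + i)) (b := i - n) (by
        rw [abs_le] at hi
        exact Finset.mem_Icc.2 hi)
    simp only [add_sub_cancel] at this
    exact this
  have hM0 : 0 ≤ M := by
    refine le_trans ?_ (hM n (by simp; omega))
    exact add_nonneg (mul_nonneg (bandSup_nonneg _ _ _ _ _) (bandSup_nonneg _ _ _ _ _))
      (mul_nonneg (bandSup_nonneg _ _ _ _ _) (bandSup_nonneg _ _ _ _ _))
  have h := tsum_bound (2 * m * (2 * m)) (m * M) (by positivity) (setK m ×ˢ setK m)
    (by rw [Finset.card_product, card_setK]) (fun r => shK r.1 + shK r.2)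
    (fun r i => coK p r.1 i * coK a r.2 (i + shK r.1) - coK a r.2 i * coK p r.1 (i + shK r.2))
    (fun r hr i => coef_le m hm n τ a p hpsupp M hM0 hM i r.1 r.2
      (Finset.mem_product.1 hr).1 (Finset.mem_product.1 hr).2) x
  simp only [comm_eq]
  refine h.trans (mul_le_mul_left (ENNReal.ofReal_le_ofReal ?_) _)
  refine pow_le_pow_left₀ (by positivity) ?_ 2
  push_cast
  have : 0 ≤ (m : ℝ) ^ 3 * M := by positivity
  nlinarith
end
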